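/- arXiv:2209.13208 — 2 statements merged into one kernel-verified Lean document; each statement's English description precedes it below -/
import Mathlib

section
/- If real numbers d, m_i (1 ≤ i ≤ 5) and m_{ij} = m_{ji} (1 ≤ i < j ≤ 5) satisfy the boundary inequalities, then the vector D = dH − Σ_i m_i E_i − Σ_{i<j} m_{ij} E_{ij} is a nonnegative real linear combination of the 25 boundary classes and the 15 Keel–Vermeire classes. (This is the numerical core of the paper's Theorem 1.3 for n = 6, expressed in the Kapranov basis.) -/
open Finset

/-- Index type for the Kapranov basis of `Pic(M̄₀,₆) ⊗ ℝ`: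
`H`, `E_i` (i ∈ Fin 5), and `E_{ij}` for `i < j`. -/
abbrev PairIdx : Type := {p : Fin 5 × Fin 5 // p.1 < p.2}

abbrev Idx : Type := Unit ⊕ Fin 5 ⊕ PairIdx

/-- The 16-dimensional real vector space `N¹(M̄₀,₆)`. -/
abbrev V : Type := Idx → ℝ

noncomputable section

/-- The hyperplane class `H`. -/
def bH : V := fun k => if k = Sum.inl () then 1 else 0

/-- The exceptional class `E_i` over the point `p_i`. -/
def bE (i : Fin 5) : V := fun k => if k = Sum.inr (Sum.inl i) then 1 else 0

/-- The exceptional class `E_{ij} = E_{ji}` over the line `l_{ij}` (for `i ≠ j`). -/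
def bEE (i j : Fin 5) : V := fun k =>
  match k with
  | Sum.inr (Sum.inr p) =>
      if (p.1.1 = i ∧ p.1.2 = j) ∨ (p.1.1 = j ∧ p.1.2 = i) then 1 else 0
  | _ => 0

/-- `D = d·H − Σᵢ mᵢ Eᵢ − Σ_{i<j} m_{ij} E_{ij}`. -/
def Dvec (d : ℝ) (m : Fin 5 → ℝ) (mm : Fin 5 → Fin 5 → ℝ) : V :=
  d • bH - ∑ i, m i • bE i - ∑ p : PairIdx, mm p.1.1 p.1.2 • bEE p.1.1 p.1.2

/-- The boundary inequalities: `D` restricts to an effective class on each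
boundary divisor of `M̄₀,₆`. -/
def BoundaryIneqs (d : ℝ) (m : Fin 5 → ℝ) (mm : Fin 5 → Fin 5 → ℝ) : Prop :=
  (∀ i j, i ≠ j → mm i j ≤ m i) ∧
  (∀ i, (∑ j ∈ univ.filter (fun j => j ≠ i), mm i j) ≤ 2 * m i) ∧
  (∀ i j k, i ≠ j → i ≠ k → j ≠ k → m i + mm j k ≤ d) ∧
  (∀ i j k h l : Fin 5, ({i, j, k, h, l} : Finset (Fin 5)) = univ →
    m i + m j + m k + mm h l ≤ 2 * d) ∧
  (∀ i j k h l : Fin 5, ({i, j, k, h, l} : Finset (Fin 5)) = univ →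
    mm i j + mm i k + mm j k + mm h l ≤ d) ∧
  (∀ i j, i ≠ j → 0 ≤ mm i j) ∧
  (∀ i j, i ≠ j → m i + m j ≤ d + mm i j)

/-- The boundary class `Δ_{ijk}`. -/
def Delta (i j k : Fin 5) : V :=
  bH - bE i - bE j - bE k - bEE i j - bEE i k - bEE j k

/-- The Keel–Vermeire class `KV_{ij,kh}`. -/
def KV (i j k h : Fin 5) : V :=
  (2 : ℝ) • bH - ∑ a, bE a - bEE i k - bEE i h - bEE j k - bEE j h

/-- The 25 boundary classes `E_i`, `E_{ij}`, `Δ_{ijk}`. -/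
def BoundaryClasses : Set V :=
  {v | (∃ i, v = bE i) ∨ (∃ i j, i ≠ j ∧ v = bEE i j) ∨
    (∃ i j k, i ≠ j ∧ i ≠ k ∧ j ≠ k ∧ v = Delta i j k)}

/-- The 15 Keel–Vermeire classes. -/
def KVClasses : Set V :=
  {v | ∃ i j k h : Fin 5, i ≠ j ∧ i ≠ k ∧ i ≠ h ∧ j ≠ k ∧ j ≠ h ∧ k ≠ h ∧
    v = KV i j k h}

/-- `v` is a nonnegative real linear combination of elements of `S`. -/
def IsNonnegCombi (S : Set V) (v : V) : Prop :=
  ∃ (n : ℕ) (c : Fin n → ℝ) (g : Fin n → V),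
    (∀ t, 0 ≤ c t) ∧ (∀ t, g t ∈ S) ∧ v = ∑ t, c t • g t

end

/-! ### Separation -/

theorem IsNonnegCombi.zero (S : Set V) : IsNonnegCombi S 0 :=
  ⟨0, Fin.elim0, Fin.elim0, fun t => t.elim0, fun t => t.elim0, by simp⟩

theorem IsNonnegCombi.of_mem {S : Set V} {v : V} (hv : v ∈ S) : IsNonnegCombi S v :=
  ⟨1, fun _ => 1, fun _ => v, fun _ => zero_le_one, fun _ => hv, by simp⟩

theorem IsNonnegCombi.smul {S : Set V} {v : V} (hv : IsNonnegCombi S v) {a : ℝ} (ha : 0 ≤ a) :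
    IsNonnegCombi S (a • v) := by
  obtain ⟨n, c, g, hc, hg, rfl⟩ := hv
  exact ⟨n, fun t => a * c t, g, fun t => mul_nonneg ha (hc t), hg, by
    simp only [Finset.smul_sum, mul_smul]⟩

theorem IsNonnegCombi.add {S : Set V} {v w : V} (hv : IsNonnegCombi S v)
    (hw : IsNonnegCombi S w) : IsNonnegCombi S (v + w) := by
  obtain ⟨n, c, g, hc, hg, rfl⟩ := hv
  obtain ⟨n', c', g', hc', hg', rfl⟩ := hw
  refine ⟨n + n', Fin.append c c', Fin.append g g', fun t => ?_, fun t => ?_, by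
    simp [Fin.sum_univ_add]⟩
  · cases t using Fin.addCases with
    | left t => simpa using hc t
    | right t => simpa using hc' t
  · cases t using Fin.addCases with
    | left t => simpa using hg t
    | right t => simpa using hg' t

/-- Farkas' lemma for a finite set on which some linear form is positive. -/
theorem IsNonnegCombi.of_forall_nonneg {S : Set V} (hS : S.Finite) {φ : V →ₗ[ℝ] ℝ}
    (hφ : ∀ g ∈ S, 0 < φ g) {v : V}
    (h : ∀ ℓ : V →ₗ[ℝ] ℝ, (∀ g ∈ S, 0 ≤ ℓ g) → 0 ≤ ℓ v) : IsNonnegCombi S v := by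
  by_contra hv
  obtain ⟨b, hb, hvb⟩ : ∃ b, 0 < b ∧ φ v < b :=
    ⟨max (φ v) 0 + 1, by positivity, by linarith [le_max_left (φ v) 0]⟩
  set T : Set V := insert 0 ((fun g => (b / φ g) • g) '' S)
  have hconv : Convex ℝ {w | IsNonnegCombi S w} := fun _ hx _ hy _ _ ha hc _ =>
    (hx.smul ha).add (hy.smul hc)
  have hT : convexHull ℝ T ⊆ {w | IsNonnegCombi S w} := by
    refine convexHull_min ?_ hconv
    rintro _ (rfl | ⟨g, hg, rfl⟩)
    · exact .zero S
    · exact (IsNonnegCombi.of_mem hg).smul (div_pos hb (hφ g hg)).le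
  obtain ⟨ℓ, u, hu, hℓ⟩ := geometric_hahn_banach_point_closed (convex_convexHull ℝ T)
    (((hS.image _).insert 0).isClosed_convexHull ℝ) fun hmem => hv (hT hmem)
  have hu0 : u < 0 := by simpa using hℓ 0 (subset_convexHull ℝ T (Set.mem_insert 0 _))
  have key := h (ℓ.toLinearMap - (u / b) • φ) fun g hg => by
    have hg' := hℓ _ (subset_convexHull ℝ T (Set.mem_insert_of_mem _ ⟨g, hg, rfl⟩))
    have hpos := hφ g hg
    rw [map_smul, smul_eq_mul, div_mul_eq_mul_div, lt_div_iff₀ hpos] at hg'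
    have : u / b * φ g < ℓ g := by
      rw [div_mul_eq_mul_div, div_lt_iff₀ hb]
      linarith
    simpa using this.le
  have : u < u / b * φ v := by
    rw [div_mul_eq_mul_div, lt_div_iff₀ hb]
    exact mul_lt_mul_of_neg_left hvb hu0
  simp only [LinearMap.sub_apply, LinearMap.smul_apply, smul_eq_mul,
    ContinuousLinearMap.coe_coe] at key
  linarith

/-! ### The classes -/

theorem sum_pairIdx (f : Fin 5 → Fin 5 → ℝ) :
    ∑ p : PairIdx, f p.1.1 p.1.2 = f 0 1 + f 0 2 + f 0 3 + f 0 4 + f 1 2 + f 1 3 + f 1 4 +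
      f 2 3 + f 2 4 + f 3 4 := by
  rw [← Finset.sum_subtype (univ.filter fun q : Fin 5 × Fin 5 => q.1 < q.2) (by simp)
    fun q => f q.1 q.2, Finset.sum_filter, Fintype.sum_prod_type]
  simp [Fin.sum_univ_five]
  ring

theorem bEE_comm (i j : Fin 5) : bEE i j = bEE j i := by
  ext (_ | _ | p) <;> simp only [bEE, or_comm]

theorem finite_classes : (BoundaryClasses ∪ KVClasses).Finite := by
  refine ((((Set.finite_range bE).union
    (Set.finite_range fun q : Fin 5 × Fin 5 => bEE q.1 q.2)).union
    (Set.finite_range fun q : Fin 5 × Fin 5 × Fin 5 => Delta q.1 q.2.1 q.2.2)).union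
    (Set.finite_range fun q : Fin 5 × Fin 5 × Fin 5 × Fin 5 =>
      KV q.1 q.2.1 q.2.2.1 q.2.2.2)).subset ?_
  rintro _ ((⟨i, rfl⟩ | ⟨i, j, -, rfl⟩ | ⟨i, j, k, -, -, -, rfl⟩) |
    ⟨i, j, k, h, -, -, -, -, -, -, rfl⟩)
  · exact .inl (.inl (.inl ⟨i, rfl⟩))
  · exact .inl (.inl (.inr ⟨(i, j), rfl⟩))
  · exact .inl (.inr ⟨(i, j, k), rfl⟩)
  · exact .inr ⟨(i, j, k, h), rfl⟩

/-- A linear form that is positive on all classes. -/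
noncomputable def degree : V →ₗ[ℝ] ℝ :=
  (11 / 2 : ℝ) • LinearMap.proj (Sum.inl ()) + ∑ i, LinearMap.proj (Sum.inr (Sum.inl i)) +
    (1 / 2 : ℝ) • ∑ p : PairIdx, LinearMap.proj (Sum.inr (Sum.inr p))

theorem degree_bH : degree bH = 11 / 2 := by simp [degree, bH]

theorem degree_bE (i : Fin 5) : degree (bE i) = 1 := by simp [degree, bE]

theorem degree_bEE {i j : Fin 5} (hij : i ≠ j) : degree (bEE i j) = 1 / 2 := by
  have : ∑ p : PairIdx, bEE i j (Sum.inr (Sum.inr p)) = 1 := by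
    simp only [bEE]
    rw [sum_pairIdx fun a b => if (a = i ∧ b = j) ∨ (a = j ∧ b = i) then (1 : ℝ) else 0]
    fin_cases i <;> fin_cases j <;> simp_all
  simp [degree, this]
  simp [bEE]

theorem degree_pos {v : V} (hv : v ∈ BoundaryClasses ∪ KVClasses) : 0 < degree v := by
  rcases hv with (⟨i, rfl⟩ | ⟨i, j, hij, rfl⟩ | ⟨i, j, k, hij, hik, hjk, rfl⟩) |
    ⟨i, j, k, h, -, hik, hih, hjk, hjh, -, rfl⟩
  · rw [degree_bE]; norm_num
  · rw [degree_bEE hij]; norm_num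
  · simp only [Delta, map_sub, degree_bH, degree_bE, degree_bEE hij, degree_bEE hik,
      degree_bEE hjk]
    norm_num
  · simp only [KV, map_sub, map_smul, map_sum, degree_bH, degree_bE, degree_bEE hik,
      degree_bEE hih, degree_bEE hjk, degree_bEE hjh]
    norm_num

/-! ### Linear forms on the weight space of `K₆`

A vector of `ℝ¹⁶` lists the weights of the fifteen edges of `K₆`, in the order
`01, 02, 03, 04, 05, 12, …, 45`, followed by a scalar `t`.  Integer forms with coefficients
in `{-1, 0, 1}` are coded by the bit masks of their positive and of their negative
coefficients. -/

namespace WeightCone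

/-- The coefficients of the form with the given positive and negative masks. -/
def coeffs (p : ℕ × ℕ) (e : ℕ) : ℤ :=
  (if p.1.testBit e then 1 else 0) - (if p.2.testBit e then 1 else 0)

/-- The defining inequalities of the weight cone: edge weights and `t` are nonnegative, and a
pair of complementary triangles, or a perfect matching, has weight at most `t`. -/
def facetTable : List (ℕ × ℕ) := [
  (1, 0), (2, 0), (4, 0), (8, 0), (16, 0), (32, 0), (64, 0), (128, 0), (256, 0), (512, 0),
  (1024, 0), (2048, 0), (4096, 0), (8192, 0), (16384, 0), (32768, 0), (32768, 28707),
  (32768, 19525), (32768, 10889), (32768, 5905), (32768, 17286), (32768, 9546), (32768, 6354),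
  (32768, 6444), (32768, 9396), (32768, 17016), (32768, 16897), (32768, 9217), (32768, 6145),
  (32768, 16450), (32768, 8322), (32768, 4354), (32768, 16420), (32768, 2180), (32768, 1284),
  (32768, 8232), (32768, 2120), (32768, 776), (32768, 4144), (32768, 1104), (32768, 656)]

/-- The generators: negated edges, triangles, and claws minus the opposite edge. -/
def genTable : List (ℕ × ℕ) := [
  (0, 1), (0, 2), (0, 4), (0, 8), (0, 16), (0, 32), (0, 64), (0, 128), (0, 256), (0, 512),
  (0, 1024), (0, 2048), (0, 4096), (0, 8192), (0, 16384), (32803, 0), (32837, 0), (32905, 0),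
  (33041, 0), (33286, 0), (33802, 0), (34834, 0), (36876, 0), (40980, 0), (49176, 0), (33376, 0),
  (33952, 0), (35104, 0), (37056, 0), (41280, 0), (49536, 0), (38400, 0), (43520, 0), (52224, 0),
  (61440, 0), (36352, 1), (45568, 1), (54272, 1), (59392, 1), (33216, 2), (45120, 2), (53376, 2),
  (57600, 2), (33184, 4), (35872, 4), (50304, 4), (51456, 4), (33120, 8), (35360, 8), (41536, 8),
  (43264, 8), (32992, 16), (34336, 16), (37440, 16), (38016, 16), (32796, 32), (45060, 32),
  (53256, 32), (57360, 32), (32794, 64), (35842, 64), (50184, 64), (51216, 64), (32790, 128),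
  (35330, 128), (41476, 128), (43024, 128), (32782, 256), (34306, 256), (37380, 256),
  (37896, 256), (32793, 512), (33153, 512), (49288, 512), (49424, 512), (32789, 1024),
  (33089, 1024), (41028, 1024), (41232, 1024), (32781, 2048), (32961, 2048), (36932, 2048),
  (37000, 2048), (32787, 4096), (33057, 4096), (34850, 4096), (35088, 4096), (32779, 8192),
  (32929, 8192), (33826, 8192), (33928, 8192), (32775, 16384), (32865, 16384), (33314, 16384),
  (33348, 16384)]

/-- The coefficients of the `k`-th facet. -/
def facet (k : ℕ) : ℕ → ℤ := coeffs (facetTable.getD k (0, 0))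

/-- The coefficients of the `k`-th generator. -/
def gen (k : ℕ) : ℕ → ℤ := coeffs (genTable.getD k (0, 0))

/-- The value of an integer form at a vector. -/
def eval (v : ℕ → ℤ) (x : ℕ → ℝ) : ℝ := ∑ e ∈ range 16, (v e : ℝ) * x e

/-- The value of an integer form at an integer vector. -/
def dot (v r : ℕ → ℤ) : ℤ := ((List.range 16).map fun e => v e * r e).sum

theorem cast_dot (v r : ℕ → ℤ) : (dot v r : ℝ) = eval v fun e => (r e : ℝ) := by
  simp [dot, eval, List.range_succ, Finset.sum_range_succ, add_assoc]

/-- Membership in the weight cone. -/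
def Feasible (x : ℕ → ℝ) : Prop := ∀ k < 41, 0 ≤ eval (facet k) x

/-- Membership in the bidual of the cone of generators. -/
def Generated (x : ℕ → ℝ) : Prop :=
  ∀ y, (∀ k < 95, 0 ≤ eval (gen k) y) → 0 ≤ ∑ e ∈ range 16, x e * y e

/-- `x` lies on all facets in the bit mask `S`. -/
def Tight (S : ℕ) (x : ℕ → ℝ) : Prop := ∀ k < 41, S.testBit k → eval (facet k) x = 0

/-- The face cut out by the facets in the bit mask `S` is generated. -/
def FaceGenerated (S : ℕ) : Prop := ∀ x, Feasible x → Tight S x → Generated x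

/-! ### Symmetries -/

/-- Action of the transpositions `(0 s)` of vertices on coordinates, for `s = 1, …, 5`. -/
def swapTable : List (List ℕ) := [
  [0, 5, 6, 7, 8, 1, 2, 3, 4, 9, 10, 11, 12, 13, 14, 15],
  [5, 1, 9, 10, 11, 0, 6, 7, 8, 2, 3, 4, 12, 13, 14, 15],
  [6, 9, 2, 12, 13, 5, 0, 7, 8, 1, 10, 11, 3, 4, 14, 15],
  [7, 10, 12, 3, 14, 5, 6, 0, 8, 9, 1, 11, 2, 13, 4, 15],
  [8, 11, 13, 14, 4, 5, 6, 7, 0, 9, 10, 1, 12, 2, 3, 15]]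

/-- Action of the transpositions `(0 s)` of vertices on facets, for `s = 1, …, 5`. -/
def facetSwapTable : List (List ℕ) := [
  [0, 5, 6, 7, 8, 1, 2, 3, 4, 9, 10, 11, 12, 13, 14, 15, 16, 17, 18, 19, 25, 24, 23, 22, 21, 20,
   26, 27, 28, 32, 35, 38, 29, 36, 39, 30, 33, 40, 31, 34, 37],
  [5, 1, 9, 10, 11, 0, 6, 7, 8, 2, 3, 4, 12, 13, 14, 15, 16, 25, 24, 23, 20, 21, 22, 19, 18, 17,
   32, 35, 38, 29, 30, 31, 26, 40, 37, 27, 39, 34, 28, 36, 33],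
  [6, 9, 2, 12, 13, 5, 0, 7, 8, 1, 10, 11, 3, 4, 14, 15, 25, 17, 22, 21, 20, 19, 18, 23, 24, 16,
   29, 39, 36, 26, 40, 37, 32, 33, 34, 38, 28, 31, 35, 27, 30],
  [7, 10, 12, 3, 14, 5, 6, 0, 8, 9, 1, 11, 2, 13, 4, 15, 24, 22, 18, 20, 19, 21, 17, 23, 16, 25,
   40, 30, 33, 39, 27, 34, 38, 28, 31, 35, 36, 37, 32, 29, 26],
  [8, 11, 13, 14, 4, 5, 6, 7, 0, 9, 10, 1, 12, 2, 3, 15, 23, 21, 20, 19, 18, 17, 22, 16, 24, 25,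
   37, 34, 31, 36, 33, 28, 35, 30, 27, 32, 29, 26, 38, 39, 40]]

/-- Action of the transpositions `(0 s)` of vertices on generators, for `s = 1, …, 5`. -/
def genSwapTable : List (List ℕ) := [
  [0, 5, 6, 7, 8, 1, 2, 3, 4, 9, 10, 11, 12, 13, 14, 15, 16, 17, 18, 25, 26, 27, 28, 29, 30, 19,
   20, 21, 22, 23, 24, 31, 32, 33, 34, 35, 36, 37, 38, 55, 56, 57, 58, 59, 60, 61, 62, 63, 64, 65,
   66, 67, 68, 69, 70, 39, 40, 41, 42, 43, 44, 45, 46, 47, 48, 49, 50, 51, 52, 53, 54, 72, 71, 73,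
   74, 76, 75, 77, 78, 80, 79, 81, 82, 84, 83, 85, 86, 88, 87, 89, 90, 92, 91, 93, 94],
  [5, 1, 9, 10, 11, 0, 6, 7, 8, 2, 3, 4, 12, 13, 14, 15, 25, 26, 27, 19, 20, 21, 31, 32, 33, 16,
   17, 18, 28, 29, 30, 22, 23, 24, 34, 55, 56, 57, 58, 39, 40, 41, 42, 72, 71, 73, 74, 76, 75, 77,
   78, 80, 79, 81, 82, 35, 36, 37, 38, 60, 59, 61, 62, 64, 63, 65, 66, 68, 67, 69, 70, 44, 43, 45,
   46, 48, 47, 49, 50, 52, 51, 53, 54, 85, 84, 83, 86, 89, 88, 87, 90, 93, 92, 91, 94],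
  [6, 9, 2, 12, 13, 5, 0, 7, 8, 1, 10, 11, 3, 4, 14, 25, 16, 28, 29, 19, 31, 32, 22, 23, 34, 15,
   26, 27, 17, 18, 30, 20, 21, 33, 24, 60, 59, 61, 62, 72, 71, 73, 74, 43, 44, 45, 46, 84, 85, 83,
   86, 88, 89, 87, 90, 56, 55, 57, 58, 36, 35, 37, 38, 65, 64, 63, 66, 69, 68, 67, 70, 40, 39, 41,
   42, 77, 76, 75, 78, 81, 80, 79, 82, 49, 47, 48, 50, 53, 51, 52, 54, 94, 92, 93, 91],
  [7, 10, 12, 3, 14, 5, 6, 0, 8, 9, 1, 11, 2, 13, 4, 26, 28, 17, 30, 31, 20, 33, 22, 34, 24, 25,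
   15, 27, 16, 29, 18, 19, 32, 21, 23, 64, 65, 63, 66, 76, 77, 75, 78, 84, 85, 83, 86, 47, 48, 49,
   50, 92, 93, 94, 91, 57, 56, 55, 58, 61, 60, 59, 62, 37, 35, 36, 38, 70, 68, 69, 67, 73, 72, 71,
   74, 41, 39, 40, 42, 82, 80, 81, 79, 45, 43, 44, 46, 90, 88, 89, 87, 54, 51, 52, 53],
  [8, 11, 13, 14, 4, 5, 6, 7, 0, 9, 10, 1, 12, 2, 3, 27, 29, 30, 18, 32, 33, 21, 34, 23, 24, 25,
   26, 15, 28, 16, 17, 31, 19, 20, 22, 68, 69, 70, 67, 80, 81, 82, 79, 88, 89, 90, 87, 92, 93, 94,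
   91, 51, 52, 53, 54, 58, 56, 57, 55, 62, 60, 61, 59, 66, 64, 65, 63, 38, 35, 36, 37, 74, 72, 73,
   71, 78, 76, 77, 75, 42, 39, 40, 41, 86, 84, 85, 83, 46, 43, 44, 45, 50, 47, 48, 49]]

/-- The permutation of coordinates induced by the transposition `(0 s)`. -/
def swapCoord (s e : ℕ) : ℕ := (swapTable.getD (s - 1) []).getD e e

/-- The permutation of facets induced by the transposition `(0 s)`. -/
def swapFacet (s k : ℕ) : ℕ := (facetSwapTable.getD (s - 1) []).getD k k

/-- The permutation of generators induced by the transposition `(0 s)`. -/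
def swapGen (s k : ℕ) : ℕ := (genSwapTable.getD (s - 1) []).getD k k

theorem swapCoord_lt : ∀ s ∈ Icc 1 5, ∀ e ∈ range 16, swapCoord s e ∈ range 16 := by
  decide +kernel

theorem swapCoord_swapCoord :
    ∀ s ∈ Icc 1 5, ∀ e ∈ range 16, swapCoord s (swapCoord s e) = e := by
  decide +kernel

theorem swapFacet_lt : ∀ s ∈ Icc 1 5, ∀ k < 41, swapFacet s k < 41 := by
  decide +kernel

theorem facet_swapFacet : ∀ s ∈ Icc 1 5, ∀ k < 41, ∀ e ∈ range 16,
    facet (swapFacet s k) e = facet k (swapCoord s e) := by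
  decide +kernel

theorem swapGen_lt : ∀ s ∈ Icc 1 5, ∀ k < 95, swapGen s k < 95 := by
  decide +kernel

theorem gen_swapGen : ∀ s ∈ Icc 1 5, ∀ k < 95, ∀ e ∈ range 16,
    gen (swapGen s k) e = gen k (swapCoord s e) := by
  decide +kernel

theorem sum_swapCoord {s : ℕ} (hs : s ∈ Icc 1 5) (f : ℕ → ℝ) :
    ∑ e ∈ range 16, f (swapCoord s e) = ∑ e ∈ range 16, f e :=
  Finset.sum_nbij' (swapCoord s) (swapCoord s) (swapCoord_lt s hs) (swapCoord_lt s hs)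
    (swapCoord_swapCoord s hs) (swapCoord_swapCoord s hs) (fun _ _ => rfl)

theorem eval_congr {v w : ℕ → ℤ} (h : ∀ e ∈ range 16, v e = w e) (x : ℕ → ℝ) :
    eval v x = eval w x :=
  Finset.sum_congr rfl fun e he => by rw [h e he]

theorem eval_comp_swapCoord {s : ℕ} (hs : s ∈ Icc 1 5) {v w : ℕ → ℤ}
    (h : ∀ e ∈ range 16, w e = v (swapCoord s e)) (x : ℕ → ℝ) :
    eval v (x ∘ swapCoord s) = eval w x := by
  rw [eval_congr h, eval, eval, ← sum_swapCoord hs]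
  refine Finset.sum_congr rfl fun e he => ?_
  simp only [Function.comp_apply, swapCoord_swapCoord s hs e he]

theorem Generated.comp_swapCoord {s : ℕ} (hs : s ∈ Icc 1 5) {x : ℕ → ℝ} (hx : Generated x) :
    Generated (x ∘ swapCoord s) := by
  intro y hy
  have := hx (y ∘ swapCoord s) fun k hk => by
    rw [eval_comp_swapCoord hs (gen_swapGen s hs k hk)]
    exact hy _ (swapGen_lt s hs k hk)
  rw [← sum_swapCoord hs] at this
  refine this.trans_eq (Finset.sum_congr rfl fun e he => ?_)
  simp only [Function.comp_apply, swapCoord_swapCoord s hs e he]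

theorem Generated.of_comp_swapCoord {s : ℕ} (hs : s ∈ Icc 1 5) {x : ℕ → ℝ}
    (hx : Generated (x ∘ swapCoord s)) : Generated x := by
  intro y hy
  refine (hx.comp_swapCoord hs y hy).trans_eq (Finset.sum_congr rfl fun e he => ?_)
  simp only [Function.comp_apply, swapCoord_swapCoord s hs e he]

/-- The action on facets of a word in the transpositions `(0 s)`. -/
def wordFacet (w : List ℕ) (k : ℕ) : ℕ := w.foldr swapFacet k

theorem wordFacet_lt {w : List ℕ} (hw : ∀ s ∈ w, s ∈ Icc 1 5) {k : ℕ} (hk : k < 41) :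
    wordFacet w k < 41 := by
  induction w with
  | nil => exact hk
  | cons s w ih => exact swapFacet_lt s (hw s (by simp)) _ (ih fun b hb => hw b (by simp [hb]))

/-- If `S` cuts out a generated face, then so does each mask containing a translate of `S`. -/
theorem FaceGenerated.of_word {S : ℕ} (hS : FaceGenerated S) (w : List ℕ)
    (hw : ∀ s ∈ w, s ∈ Icc 1 5) {x : ℕ → ℝ} (hx : Feasible x)
    (ht : ∀ k < 41, S.testBit k → eval (facet (wordFacet w k)) x = 0) : Generated x := by
  induction w generalizing x with
  | nil => exact hS x hx ht
  | cons s w ih =>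
    have hs := hw s (by simp)
    have key : ∀ k < 41, eval (facet k) (x ∘ swapCoord s) = eval (facet (swapFacet s k)) x :=
      fun k hk => eval_comp_swapCoord hs (facet_swapFacet s hs k hk) x
    have hw' : ∀ b ∈ w, b ∈ Icc 1 5 := fun b hb => hw b (by simp [hb])
    refine (ih hw' (fun k hk => ?_) fun k hk hSk => ?_).of_comp_swapCoord hs
    · rw [key k hk]
      exact hx _ (swapFacet_lt s hs k hk)
    · rw [key _ (wordFacet_lt hw' hk)]
      exact ht k hk hSk

/-! ### Combinations -/

theorem eval_add_smul (v : ℕ → ℤ) (x z : ℕ → ℝ) (a : ℝ) :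
    eval v (fun e => x e + a * z e) = eval v x + a * eval v z := by
  simp only [eval, mul_add, Finset.sum_add_distrib, Finset.mul_sum]
  congr 1
  exact Finset.sum_congr rfl fun e _ => by ring

theorem Generated.add_smul {x z : ℕ → ℝ} {a : ℝ} (hx : Generated x) (hz : Generated z)
    (ha : 0 ≤ a) : Generated fun e => x e + a * z e := by
  intro y hy
  have := add_nonneg (hx y hy) (mul_nonneg ha (hz y hy))
  rw [Finset.mul_sum, ← Finset.sum_add_distrib] at this
  exact this.trans_eq (Finset.sum_congr rfl fun e _ => by ring)

/-- The integer combination of the forms `f k` with coefficients `c`, for `(k, c)` in `L`. -/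
def comb (f : ℕ → ℕ → ℤ) (L : List (ℕ × ℤ)) (e : ℕ) : ℤ := (L.map fun q => q.2 * f q.1 e).sum

theorem eval_comb (f : ℕ → ℕ → ℤ) (L : List (ℕ × ℤ)) (x : ℕ → ℝ) :
    eval (comb f L) x = (L.map fun q => (q.2 : ℝ) * eval (f q.1) x).sum := by
  induction L with
  | nil => simp [eval, comb]
  | cons q L ih =>
    rw [List.map_cons, List.sum_cons, ← ih]
    simp only [eval, comb, List.map_cons, List.sum_cons, Int.cast_add, Int.cast_mul, add_mul,
      Finset.sum_add_distrib, Finset.mul_sum, mul_assoc]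

theorem generated_comb_gen (L : List (ℕ × ℤ)) (hL : ∀ q ∈ L, q.1 < 95 ∧ 0 ≤ q.2) :
    Generated fun e => (comb gen L e : ℝ) := by
  intro y hy
  change 0 ≤ eval (comb gen L) y
  rw [eval_comb]
  refine List.sum_nonneg fun a ha => ?_
  obtain ⟨q, hq, rfl⟩ := List.mem_map.1 ha
  exact mul_nonneg (by exact_mod_cast (hL q hq).2) (hy _ (hL q hq).1)

/-- The facets, packed as integers in base `10000`. -/
def packedFacetTable : List ℤ := [
  1, 10000, 100000000, 1000000000000, 10000000000000000, 100000000000000000000,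
  1000000000000000000000000, 10000000000000000000000000000, 100000000000000000000000000000000,
  1000000000000000000000000000000000000, 10000000000000000000000000000000000000000,
  100000000000000000000000000000000000000000000,
  1000000000000000000000000000000000000000000000000,
  10000000000000000000000000000000000000000000000000000,
  100000000000000000000000000000000000000000000000000000000,
  1000000000000000000000000000000000000000000000000000000000000,
  999899989998999999999999999999999999999899999999999999989999,
  999899999999999899989999999999999998999999999999999899999999,
  999999989999999899999998999999989999999999999998999999999999,
  999999999998999999989998999899999999999999989999999999999999,
  999899999999999999999998999899989999999999999999999899990000,
  999999989999999999989999999899999998999999999998999999990000,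
  999999999998999899999999999999989998999999989999999999990000,
  999999999998999899999999999899999999999899999998999900000000,
  999999989999999999989999999999989999999899989999999900000000,
  999899999999999999999998999999999998999899989999000000000000,
  999899999999999999999998999999999999999999999999999999999999,
  999999989999999999989999999999999999999999999999999999999999,
  999999999998999899999999999999999999999999999999999999999999,
  999899999999999999999999999999999998999999999999999999990000,
  999999989999999999999999999999989999999999999999999999990000,
  999999999998999999999999999899999999999999999999999999990000,
  999899999999999999999999999999999999999899999999999900000000,
  999999999999999899999999999999989999999999999999999900000000,
  999999999999999999989999999899999999999999999999999900000000,
  999999989999999999999999999999999999999899999999000000000000,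
  999999999999999899999999999999999998999999999999000000000000,
  999999999999999999999998999899999999999999999999000000000000,
  999999999998999999999999999999999999999899990000000000000000,
  999999999999999999989999999999999998999999990000000000000000,
  999999999999999999999998999999989999999999990000000000000000]

theorem getD_packedFacetTable : ∀ k < 41,
    packedFacetTable.getD k 0 = ∑ e ∈ range 16, facet k e * 10000 ^ e := by
  decide +kernel

theorem abs_coeffs_le (p : ℕ × ℕ) (e : ℕ) : |coeffs p e| ≤ 1 := by
  unfold coeffs
  split_ifs <;> simp

theorem eq_zero_of_sum_mul_pow_eq_zero {b : ℤ} {n : ℕ} {a : ℕ → ℤ} (ha : ∀ e < n, |a e| < b)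
    (h : ∑ e ∈ range n, a e * b ^ e = 0) : ∀ e < n, a e = 0 := by
  induction n generalizing a with
  | zero => intro e he; omega
  | succ n ih =>
    rw [Finset.sum_range_succ'] at h
    have hb : 0 < b := (abs_nonneg _).trans_lt (ha 0 n.succ_pos)
    have hsum : ∑ e ∈ range n, a (e + 1) * b ^ (e + 1) =
        b * ∑ e ∈ range n, a (e + 1) * b ^ e := by
      rw [Finset.mul_sum]
      exact Finset.sum_congr rfl fun e _ => by ring
    rw [hsum, pow_zero, mul_one] at h
    have h0 : a 0 = 0 := Int.eq_zero_of_abs_lt_dvd ⟨-∑ e ∈ range n, a (e + 1) * b ^ e, by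
      linarith⟩ (ha 0 n.succ_pos)
    rw [h0, add_zero] at h
    have := ih (fun e he => ha (e + 1) (by omega)) ((mul_eq_zero.1 h).resolve_left hb.ne')
    intro e he
    cases e with
    | zero => exact h0
    | succ e => exact this e (by omega)

/-- A combination of facets with small coefficients vanishes if its packed value does. -/
theorem comb_facet_eq_zero {L : List (ℕ × ℤ)} (hL : ∀ q ∈ L, q.1 < 41)
    (hb : (L.map fun q => |q.2|).sum < 10000)
    (h : (L.map fun q => q.2 * packedFacetTable.getD q.1 0).sum = 0) :
    ∀ e < 16, comb facet L e = 0 := by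
  refine eq_zero_of_sum_mul_pow_eq_zero (b := 10000) (fun e _ => lt_of_le_of_lt ?_ hb) ?_
  · clear hb h hL
    induction L with
    | nil => simp [comb]
    | cons q L ih =>
      simp only [comb, List.map_cons, List.sum_cons] at ih ⊢
      refine (abs_add_le _ _).trans (add_le_add ?_ ih)
      rw [abs_mul]
      exact mul_le_of_le_one_right (abs_nonneg _) (abs_coeffs_le _ _)
  · rw [← h]
    clear hb h
    induction L with
    | nil => simp [comb]
    | cons q L ih =>
      simp only [comb, List.map_cons, List.sum_cons, add_mul, Finset.sum_add_distrib] at ih ⊢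
      rw [ih fun p hp => hL p (by simp [hp]), getD_packedFacetTable _ (hL q (by simp)),
        Finset.mul_sum]
      simp only [mul_assoc]

/-- Pulling: a face is generated as soon as it has a generated vector `r` such that the subfaces
on the facets not containing `r` are generated. -/
theorem faceGenerated_of_pull {S : ℕ} (r : ℕ → ℤ) (hr : Generated fun e => (r e : ℝ))
    (hS : ∀ k < 41, S.testBit k → dot (facet k) r = 0)
    (hpos : ∃ k < 41, 0 < dot (facet k) r)
    (hcov : ∀ k < 41, 0 < dot (facet k) r →
      ∀ z, Feasible z → Tight S z → eval (facet k) z = 0 → Generated z) :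
    FaceGenerated S := by
  intro x hx ht
  set p : ℕ → ℝ := fun k => eval (facet k) fun e => (r e : ℝ) with hp
  have hcast : ∀ k, (dot (facet k) r : ℝ) = p k := fun k => cast_dot _ _
  have hpos_iff : ∀ k, 0 < dot (facet k) r ↔ 0 < p k := fun k => by
    rw [← hcast]; exact Int.cast_pos.symm
  obtain ⟨k₀, hk₀, h₀⟩ := hpos
  obtain ⟨k, hk, hmin⟩ := Finset.exists_min_image ((range 41).filter fun k => 0 < p k)
    (fun k => eval (facet k) x / p k) ⟨k₀, by simp [hk₀, ← hpos_iff, h₀]⟩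
  simp only [Finset.mem_filter, Finset.mem_range] at hk hmin
  set a := eval (facet k) x / p k with ha
  have ha0 : 0 ≤ a := div_nonneg (hx k hk.1) hk.2.le
  have hz : ∀ l, eval (facet l) (fun e => x e + (-a) * (r e : ℝ)) = eval (facet l) x - a * p l :=
    fun l => by rw [eval_add_smul]; ring
  have hgen : Generated fun e => x e + (-a) * (r e : ℝ) := by
    refine hcov k hk.1 ((hpos_iff k).2 hk.2) _ (fun l hl => ?_) (fun l hl hSl => ?_) ?_
    · rw [hz]
      rcases le_or_gt (p l) 0 with h | h
      · nlinarith [hx l hl]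
      · have := (le_div_iff₀ h).1 (hmin l ⟨hl, h⟩)
        linarith
    · have h0 : p l = 0 := by rw [← hcast, hS l hl hSl, Int.cast_zero]
      rw [hz, ht l hl hSl, h0]; ring
    · rw [hz, ha, div_mul_cancel₀ _ hk.2.ne', sub_self]
  have := hgen.add_smul hr ha0
  simpa using this

/-! ### Certificates -/

/-- The base `b` digits of `n`, least significant first, stopping at a zero or when the first
argument is exhausted. -/
def unpack (b : ℕ) : ℕ → ℕ → List ℕ
  | 0, _ => []
  | fuel + 1, n => if n = 0 then [] else n % b :: unpack b fuel (n / b)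

/-- Decodes a combination: the base `10000` digit `100 * (c + 50) + k` stands for the
coefficient `c` at the index `k`. -/
def terms (n : ℕ) : List (ℕ × ℤ) :=
  (unpack 10000 50 n).map fun q => (q % 100, ((q / 100 : ℕ) : ℤ) - 50)

/-- A pulling step for the face with mask `face`: the vector `ray` to be pulled, coded as a
combination of generators; masks `N` of generated subfaces, each given as a triple `(N, S, w)`
where `S` is an earlier face and `w` a word moving `S` into `N`; and for each facet off the ray
a combination of facets that vanishes and starts with the given one. -/
structure PullStep where
  face : ℕ
  ray : ℕ
  subfaces : List (ℕ × ℕ × ℕ)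
  covers : List ℕ

/-- Checks that a subface mask contains a translate of a known face. -/
def checkSubface (known : List ℕ) (q : ℕ × ℕ × ℕ) : Bool :=
  known.contains q.2.1 && (unpack 10 10 q.2.2).all (fun s => decide (1 ≤ s ∧ s ≤ 5)) &&
    (List.range 41).all fun k =>
      !q.2.1.testBit k || q.1.testBit (wordFacet (unpack 10 10 q.2.2) k)

/-- Checks that on `S` and the first facet of `L` all facets of `L` vanish. -/
def checkVanishing (S : ℕ) (L : List (ℕ × ℤ)) : Bool :=
  (L.all fun q => decide (q.1 < 41)) && (L.tail.all fun q => S.testBit q.1 || decide (0 < q.2)) &&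
    decide ((L.map fun q => |q.2|).sum < 10000) &&
    (L.map fun q => q.2 * packedFacetTable.getD q.1 0).sum == 0

/-- Checks that the facets of `S` and of `L` include those of a subface or a covered facet. -/
def checkReach (S : ℕ) (subs cov : List ℕ) (L : List (ℕ × ℤ)) : Bool :=
  (L.tail.any fun q => cov.contains q.1) ||
    subs.any fun N => (List.range 41).all fun k =>
      !N.testBit k || S.testBit k || L.any fun q => q.1 == k

/-- Checks that every facet positive on `r` is covered. -/
def checkCovers (S : ℕ) (subs : List ℕ) (r : ℕ → ℤ) : List ℕ → List ℕ → Bool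
  | cov, [] => (List.range 41).all fun k =>
      cov.contains k || decide (dot (facet k) r ≤ 0)
  | cov, n :: ns =>
      checkVanishing S (terms n) && checkReach S subs cov (terms n) &&
        checkCovers S subs r (((terms n).headD (0, 0)).1 :: cov) ns

/-- Checks a pulling step, given the masks of the faces already known to be generated. -/
def checkStep (known : List ℕ) (p : PullStep) : Bool :=
  ((terms p.ray).all fun q => decide (q.1 < 95 ∧ 0 ≤ q.2)) &&
  p.subfaces.all (checkSubface known) &&
  ((List.range 41).all fun k =>
    !p.face.testBit k || dot (facet k) (comb gen (terms p.ray)) == 0) &&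
  ((List.range 41).any fun k => decide (0 < dot (facet k) (comb gen (terms p.ray)))) &&
  checkCovers p.face (p.subfaces.map Prod.fst) (comb gen (terms p.ray)) [] p.covers

/-- Checks a list of pulling steps that ends with the whole cone. -/
def checkSteps : List ℕ → List PullStep → Bool
  | known, [] => known.contains 0
  | known, p :: ps => checkStep known p && checkSteps (p.face :: known) ps

/-- Every `x` in the face `S` that lies on the facet `k` is generated. -/
def Covered (S k : ℕ) : Prop :=
  ∀ x, Feasible x → Tight S x → eval (facet k) x = 0 → Generated x

theorem faceGenerated_of_checkSubface {known : List ℕ} (hk : ∀ S ∈ known, FaceGenerated S)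
    {q : ℕ × ℕ × ℕ} (h : checkSubface known q) : FaceGenerated q.1 := by
  simp only [checkSubface, Bool.and_eq_true, List.contains_iff_mem, List.all_eq_true,
    decide_eq_true_eq, List.mem_range, Bool.or_eq_true, Bool.not_eq_true'] at h
  obtain ⟨⟨hS, hw⟩, hq⟩ := h
  intro x hx ht
  have hw' : ∀ s ∈ unpack 10 10 q.2.2, s ∈ Icc 1 5 := fun s hs => Finset.mem_Icc.2 (hw s hs)
  refine (hk _ hS).of_word _ hw' hx fun k hk41 hSk => ht _ (wordFacet_lt hw' hk41) ?_
  simpa [hSk] using hq k hk41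

theorem eval_eq_zero_of_checkVanishing {S : ℕ} {L : List (ℕ × ℤ)} (h : checkVanishing S L)
    {x : ℕ → ℝ} (hx : Feasible x) (ht : Tight S x)
    (h0 : eval (facet (L.headD (0, 0)).1) x = 0) :
    ∀ q ∈ L, eval (facet q.1) x = 0 := by
  simp only [checkVanishing, Bool.and_eq_true, List.all_eq_true, decide_eq_true_eq,
    Bool.or_eq_true, beq_iff_eq] at h
  obtain ⟨⟨⟨hlt, hS⟩, hb⟩, hz⟩ := h
  have hsum : (L.map fun q => (q.2 : ℝ) * eval (facet q.1) x).sum = 0 := by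
    rw [← eval_comb, eval_congr (w := 0)
      fun e he => comb_facet_eq_zero hlt hb hz e (Finset.mem_range.1 he)]
    simp [eval]
  cases L with
  | nil => simp
  | cons p L =>
    simp only [List.headD_cons, List.tail_cons, List.map_cons, List.sum_cons] at h0 hS hsum
    rw [h0, mul_zero, zero_add] at hsum
    have hnonneg : ∀ q ∈ L, 0 ≤ (q.2 : ℝ) * eval (facet q.1) x := fun q hq => by
      have hq41 := hlt q (by simp [hq])
      rcases hS q hq with h | h
      · rw [ht _ hq41 h, mul_zero]
      · exact mul_nonneg (by exact_mod_cast h.le) (hx _ hq41)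
    intro q hq
    rcases List.mem_cons.1 hq with rfl | hq
    · exact h0
    · rcases hS q hq with h | h
      · exact ht _ (hlt q (by simp [hq])) h
      · have := List.all_zero_of_le_zero_le_of_sum_eq_zero
          (fun r hr => by
            obtain ⟨q, hq, rfl⟩ := List.mem_map.1 hr
            exact hnonneg q hq) hsum
          (List.mem_map.2 ⟨q, hq, rfl⟩)
        exact (mul_eq_zero.1 this).resolve_left (by exact_mod_cast h.ne')

theorem covered_of_checkReach {S : ℕ} {subs cov : List ℕ} {L : List (ℕ × ℤ)}
    (hsubs : ∀ N ∈ subs, FaceGenerated N) (hcov : ∀ k ∈ cov, Covered S k)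
    (hv : checkVanishing S L) (hr : checkReach S subs cov L) :
    Covered S (L.headD (0, 0)).1 := by
  intro x hx ht h0
  have hL := eval_eq_zero_of_checkVanishing hv hx ht h0
  simp only [checkReach, Bool.or_eq_true, List.any_eq_true, List.all_eq_true, List.mem_range,
    List.contains_iff_mem, Bool.not_eq_true', beq_iff_eq] at hr
  rcases hr with ⟨q, hq, hqc⟩ | ⟨N, hN, hNS⟩
  · exact hcov _ hqc x hx ht (hL q (List.mem_of_mem_tail hq))
  · refine hsubs N hN x hx fun k hk hNk => ?_
    rcases hNS k hk with (h | h) | ⟨q, hq, rfl⟩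
    · simp [hNk] at h
    · exact ht k hk h
    · exact hL q hq

theorem covered_of_checkCovers {S : ℕ} {subs : List ℕ} {r : ℕ → ℤ} {cov ns : List ℕ}
    (hsubs : ∀ N ∈ subs, FaceGenerated N) (hcov : ∀ k ∈ cov, Covered S k)
    (h : checkCovers S subs r cov ns) : ∀ k < 41, 0 < dot (facet k) r → Covered S k := by
  induction ns generalizing cov with
  | nil =>
    simp only [checkCovers, List.all_eq_true, List.mem_range, Bool.or_eq_true,
      List.contains_iff_mem, decide_eq_true_eq] at h
    intro k hk hpos
    exact hcov k ((h k hk).resolve_right hpos.not_ge)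
  | cons n ns ih =>
    simp only [checkCovers, Bool.and_eq_true] at h
    refine ih (fun k hk => ?_) h.2
    rcases List.mem_cons.1 hk with rfl | hk
    · exact covered_of_checkReach hsubs hcov h.1.1 h.1.2
    · exact hcov k hk

theorem faceGenerated_of_checkStep {known : List ℕ} (hk : ∀ S ∈ known, FaceGenerated S)
    {p : PullStep} (h : checkStep known p) : FaceGenerated p.face := by
  simp only [checkStep, Bool.and_eq_true, List.all_eq_true, List.any_eq_true, List.mem_range,
    Bool.or_eq_true, Bool.not_eq_true', decide_eq_true_eq, beq_iff_eq] at h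
  obtain ⟨⟨⟨⟨hL, hsub⟩, hS⟩, hpos⟩, hc⟩ := h
  refine faceGenerated_of_pull _ (generated_comb_gen _ hL) (fun k hk hSk => ?_) hpos
    (covered_of_checkCovers (fun N hN => ?_) (by simp) hc)
  · simpa [hSk] using hS k hk
  · obtain ⟨q, hq, rfl⟩ := List.mem_map.1 hN
    exact faceGenerated_of_checkSubface hk (hsub q hq)

theorem faceGenerated_zero_of_checkSteps {known : List ℕ} {ps : List PullStep}
    (hk : ∀ S ∈ known, FaceGenerated S) (h : checkSteps known ps) : FaceGenerated 0 := by
  induction ps generalizing known with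
  | nil => exact hk 0 (by simpa [checkSteps] using h)
  | cons p ps ih =>
    simp only [checkSteps, Bool.and_eq_true] at h
    refine ih (fun S hS => ?_) h.2
    rcases List.mem_cons.1 hS with rfl | hS
    · exact faceGenerated_of_checkStep hk h.1
    · exact hk S hS

/-- Pulling steps, by increasing dimension of the faces. -/
def pullSteps : List PullStep := [
  ⟨121575934, 51685142, [(32768, 32768, 0)],
   [5015, 492549204919491851175116521548084807480448034609,
    492449214919511849175116521548084806480448024610,
    492449215119491851174916521548074805480348014613,
    492549205119511849174916521548064805480248014614, 51154912491149074906490449014922,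
    51154912491149084905490349024923, 492549245123512249214920511951185117511652154628,
    522651225121491949184829, 522949255124511849174830,
    492549245123512251215120511949184917511652154631, 522651245123491949184832,
    492551245123512249215120491951185117491652154633, 523249255121511949164834,
    523251214920511849174835, 512549245123512251214920491951185117491652154636,
    522651235121491749164837, 512551245123512249214920511949184917511652154638,
    522951244920511949164839, 522651245122491749164840]⟩,
  ⟨8352380, 51725168, [(285173500, 121575934, 3142)],
   [52285221512051184716481446125210520952075206440548024723,
    5130512349184916491449134909510851024800, 5127512349214916491449135111490651024801,
    51234920491851165212480952054807, 49215120511849175209520748064810, 51305113510751014915,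
    51154914490949064905490449034925,
    51254822482151205119511853175316521552135212521152104609540554024226,
    51224921511951185209520752044828, 522651225121491949184829, 522851215120491849174831,
    512551245123492249215120491949185117511652154632, 522851245120491949164833,
    522751235120491849164834, 512551245123492251214920491951184917511652154635,
    522851255121491949164836, 522651235121491749164837,
    512551245123512249214920511949184917511652154638, 522751255122491849164839,
    522651245122491749164840]⟩,
  ⟨102695423, 51575148, [(121575934, 121575934, 0)],
   [542652245221511945184517511652125308470747065305530447034702530146004011,
    49255123491951175211480452024809, 49195118511749165211490851075106490549045103510249014812,
    51224920511949175212520448024814, 51285112511151004915,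
    4926511851175211490851075102490151004921, 5121510849075106490549045103490251014924,
    522649255124512149204827, 522651225121491949184829, 522751225120491949174830,
    522851215120491849174831, 522651245123491949184832, 522851245120491949164833,
    522751235120491849164834, 522751255123491949174835, 522851255121491949164836,
    522651235121491749164837, 522851255124491849174838, 522751255122491849164839,
    522651245122491749164840]⟩,
  ⟨8351868, 5164, [(8352380, 8352380, 0)],
   [5009, 49224921511951185209480652004801, 49225120511949175209520848064811,
    51265114510951004915, 51205119491648135209520848054924, 49225121511951185209520852034827,
    522751225120491949174830, 512551245123492249215120491949185117511652154632,
    522851245120491949164833, 522751235120491849164834,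
    512551245123492251214920491951184917511652154635,
    512551245123512249214920511949184917511652154638, 522751255122491849164839,
    522651245122491749164840]⟩,
  ⟨8351804, 5160, [(8352828, 8351868, 121343), (8353852, 8351868, 1213543)],
   [5010, 5011, 51244922511749164812521052024801, 51345110510851024915,
    51215119491648145210520848054925, 49225120511951175210520852024826, 522651225121491949184829,
    512551245123492249215120491949185117511652154632,
    512551245123492251214920491951184917511652154635, 522851255121491949164836,
    522651235121491749164837, 512551245123512249214920511949184917511652154638,
    522751255122491849164839, 522651245122491749164840]⟩,
  ⟨16711932, 5164515651455127, [(285173500, 121575934, 3142)],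
   [5228522347225321482047194718521752165214521352104207520654054404520352024209,
    49224921511951185209480652004801, 4923512251075106490551044903490251014908,
    49215120511849175209520748064810, 49225120511949175209520848064811,
    49235120511849165209520748054812, 51224921511949185212520448034813,
    51224920511949175212520448024814, 51195112511051095108510451004915,
    5121510849075106490549045103490251014924, 5120510851074906490549044903510251014925,
    51254923492249215120511951185117511651155113511051075105510451024626,
    51244923492251214920511951185117511651155114510951065105510451034627,
    51224921511951185209520752044828, 522651225121491949184829, 522751225120491949174830,
    522851215120491849174831, 512551245123492249215120491949185117511652154632,
    522851245120491949164833, 522751235120491849164834,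
    512551245123492251214920491951184917511652154635, 522851255121491949164836,
    522651235121491749164837, 512551245123512249214920511949184917511652154638,
    512551244923512251214920511949185117491652154639,
    512551244923512249215120511951184917491652154640]⟩,
  ⟨16711804, 515451385118, [(16711932, 16711932, 0)],
   [5007, 51244923512249215207520448034808, 49215120511849175209520748064810,
    51244923511949185210520448034811, 49235120511849165209520748054812,
    51224921511949185212520448034813, 51224920511949175212520448024814,
    51225112511151075106510451014915, 5120510851074906490549044903510251014925,
    51254923492249215120511951185117511651155113511051075105510451024626,
    51244923492251214920511951185117511651155114510951065105510451034627,
    51224921511951185209520752044828, 522651225121491949184829, 522751225120491949174830,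
    522851215120491849174831, 512551245123492249215120491949185117511652154632,
    522851245120491949164833, 522751235120491849164834,
    512551245123492251214920491951184917511652154635, 522851255121491949164836,
    522651235121491749164837, 512551245123512249214920511949184917511652154638,
    512551244923512251214920511949185117491652154639,
    512551244923512249215120511951184917491652154640]⟩,
  ⟨8323708, 515451385118, [(8352380, 8352380, 0)],
   [482251215120481951185117521452134604520352024612, 51234920491851165212480952054807,
    512451224921492049185116521248095205520448034808, 51234921491751165212480652054810,
    49225120511949175209520848064811, 51224921511949185212520448034813,
    51224920511949175212520448024814, 51215113511051085106510351014915,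
    49224921512051175116521548094606480546044603520252004725,
    51254822482151205119511853175316521552135212521152104609540554024226,
    49225121511951185209520852034827, 51224921511951185209520752044828, 522651225121491949184829,
    522751225120491949174830, 522851215120491849174831,
    512551245123492249215120491949185117511652154632, 522851245120491949164833,
    522751235120491849164834, 512551245123492251214920491951184917511652154635,
    522851255121491949164836, 522651235121491749164837,
    512551245123512249214920511949184917511652154638, 522751255122491849164839,
    522651245122491749164840]⟩,
  ⟨13566079, 5130, [(282001919, 102695423, 3543)],
   [512851234822510848065105480451035102480151004807, 4923512251075106490551044903490251014908,
    51235121491749165208520348004814, 513251315130512649165114510951085107510251014715,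
    49225121511951185209520852034827, 5122510751065104510149004928, 522751255123491949174835,
    522851255121491949164836, 522851255124491849174838, 522751255122491849164839]⟩,
  ⟨102695150, 5179517651645262514951455142, [(102695423, 102695423, 0)],
   [482651255120510851075106510551045103510251014800, 5126492549064905490351004904,
    5126492049074902490151004908, 492549205119491851175116521252104807480352004809,
    51194918491751165212510849074906510551044903490251014811,
    51194918511749165210510849075106490551044903510249014813, 4926511951125110510851044914,
    51265114510951004915, 4926511951165212490651055104490351004921,
    4926511951175210510849075102490151004922,
    4826512251205119511752105207520648055204480352014823,
    4826512551215119511652125208480752065203480252014824, 522649255124512149204827,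
    522649255123512249204828, 522651225121491949184829, 522751225120491949174830,
    522851215120491849174831, 522651245123491949184832, 522851245120491949164833,
    522751235120491849164834, 522751255123491949174835, 522851255121491949164836,
    522651235121491749164837, 522851255124491849174838, 522751255122491849164839,
    522651245122491749164840]⟩,
  ⟨8323676, 5126, [(8323708, 8323708, 0)],
   [5005, 51234920491851165212480952054807, 49215120511849175209520748064810,
    513851325130512749165113511051075105510451024715,
    51254822482151205119511853175316521552135212521152104609540554024226,
    51224921511951185209520752044828, 522651225121491949184829, 522851215120491849174831,
    522851255121491949164836, 522651235121491749164837]⟩,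
  ⟨16711740, 515451385118, [(16711868, 16711804, 343), (16712764, 16711804, 121343)],
   [5007, 5010, 51244923512249215207520448034808, 51244923511949185210520448034811,
    49235120511849165209520748054812, 51224921511949185212520448034813,
    51224920511949175212520448024814, 51225112511151075106510451014915,
    49235122512052074805480352014925,
    51254923492249215120511951185117511651155113511051075105510451024626,
    51244923492251214920511951185117511651155114510951065105510451034627,
    51224921511951185209520752044828, 522651225121491949184829, 522751225120491949174830,
    522851215120491849174831, 512551245123492249215120491949185117511652154632,
    522851245120491949164833, 522751235120491849164834,
    512551245123492251214920491951184917511652154635, 522851255121491949164836,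
    522651235121491749164837, 512551245123512249214920511949184917511652154638,
    512551244923512251214920511949185117491652154639,
    512551244923512249215120511951184917491652154640]⟩,
  ⟨3871474, 51835174516151565147524552425119521852075404, [(12523250, 8351868, 125432)],
   [512348215120511848175116521252095207460652054610,
    51214919511749164812511151104909520649054904510351024900,
    4920511751115110490949075106490151004908, 5117491649125111511051064905510249014913,
    51214920511749164912511152104909490752064905510349014914, 51195112511051095108510451004915,
    51214920511752104809480752064918, 5118511349125109490649045103490151004922,
    51205118491648125209520748054923, 51214919511751144912511149094907520649054804510351014924,
    51214919511652134809480452014925, 51254921511951165212520552044826,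
    51214920511851175211520652034827,
    53235122472147205319521852175116521552105209540554045203520246014228,
    512651094906490151004929, 522751225120491949174830, 5128512151204917511349125109510751034831,
    51255124512348215320481953175116521554115209540752064605520152004232,
    522851245120491949164833, 51245120511949165209520752044834, 522751255123491949174835,
    522851255121491949164836, 522651235121491749164837, 523151255124492149204838,
    522951244920511949164839, 522651245122491749164840]⟩,
  ⟨8323196, 5164, [(8323708, 8323708, 0), (25100412, 16711804, 454)],
   [5009, 5024, 49224921511951185209480652004801, 49225120511949175209520848064811,
    51265114510951004915, 49225121511951185209520852034827, 522751225120491949174830,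
    512551245123492249215120491949185117511652154632, 522851245120491949164833,
    522751235120491849164834, 512551245123492251214920491951184917511652154635,
    512551245123512249214920511949184917511652154638, 522751255122491849164839,
    522651245122491749164840]⟩,
  ⟨13566063, 51385118, [(13566079, 13566079, 0)],
   [5004, 4923512251075106490551044903490251014908, 51215120491849175208520148004811,
    51235120491849165208520248004813, 51235121491749165208520348004814,
    51235112511151085105510351024915, 51254922511851165213520552034826,
    49225121511951185209520852034827, 5122510751065104510149004928, 522651225121491949184829,
    522751225120491949174830, 522851215120491849174831, 522651245123491949184832,
    522851245120491949164833, 522751235120491849164834, 522751255123491949174835,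
    522851255121491949164836, 522651235121491749164837, 522851255124491849174838,
    522751255122491849164839, 522651245122491749164840]⟩,
  ⟨13566190, 51385118, [(282001646, 102695150, 2342)],
   [5028, 5128492249074906490151004904, 5128492349054903490251004908,
    51254923511949175209520448024811, 52284923512049184916480548034813,
    52284923512149174916480548024814, 51285112511151004915, 522851254923492251204826,
    522851244923492251214827, 522651225121491949184829, 522751225120491949174830,
    522851215120491849174831, 522651245123491949184832, 522851245120491949164833,
    522751235120491849164834, 522751255123491949174835, 522851255121491949164836,
    522651235121491749164837, 522851255124491849174838, 522751255122491849164839,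
    522651245122491749164840]⟩,
  ⟨102695086, 5176, [(102695150, 102695150, 0)],
   [5006, 4926512551065105510451034900, 5126492049074902490151004908, 51265114510951004915,
    4826512551215119511652125208480752065203480252014824, 522649255124512149204827,
    522751225120491949174830, 522651245123491949184832, 522851245120491949164833,
    522751235120491849164834, 522751255123491949174835, 522851255124491849174838,
    522751255122491849164839, 522651245122491749164840]⟩,
  ⟨13566059, 5154, [(13566187, 13566063, 1343)],
   [5007, 51225120491949175207520148004810, 49235120511849165209520748054812,
    51305113510751014915, 49235122512052074805480352014925, 522851254923492251204826,
    522651225121491949184829, 522651245123491949184832, 522751255123491949174835,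
    522851255121491949164836, 522651235121491749164837, 522851255124491849174838,
    522751255122491849164839, 522651245122491749164840]⟩,
  ⟨3871472, 51795160514751465133511552115205, [(3871474, 3871474, 0), (3887856, 3871474, 2425), (12523248, 8351804, 125432)],
   [5001, 5014, 512348215120511848175116521252095207460652054610,
    5121491951134912490951064904510351014900,
    49204919511751165114511351114809490751065105490451004808, 51195112511051095108510451004915,
    51214920511752104809480752064918, 51204919511752144812480452024922,
    51205118491648125209520748054923, 51214919511751144912511149094907520649054804510351014924,
    51214919511652134809480452014925, 51254921511951165212520552044826,
    51214920511851175211520652034827, 51224921511951185209520752044828,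
    51255121491951165213520552034829, 522751225120491949174830,
    5128512151204917511349125109510751034831,
    51255124512348215320481953175116521554115209540752064605520152004232,
    522851245120491949164833, 51235121511749165211520652034834, 522751255123491949174835,
    522851255121491949164836, 522651235121491749164837, 523151255124492149204838,
    522951244920511949164839, 522651245122491749164840]⟩,
  ⟨8323132, 515451385118, [(8323260, 8323196, 343), (8323388, 8323196, 3543), (8324156, 8323196, 121343), (8325180, 8323196, 1213543), (41877564, 16711740, 3453), (8351804, 8351804, 0)],
   [5007, 5008, 5010, 5011, 5025, 482251215120481951185117521452134604520352024612,
    51224921511949185212520448034813, 51224920511949175212520448024814,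
    51215113511051085106510351014915, 49225120511951175210520852024826,
    49225121511951185209520852034827, 51224921511951185209520752044828, 522651225121491949184829,
    522751225120491949174830, 522851215120491849174831,
    512551245123492249215120491949185117511652154632, 522851245120491949164833,
    522751235120491849164834, 512551245123492251214920491951184917511652154635,
    522851255121491949164836, 522651235121491749164837,
    512551245123512249214920511949184917511652154638, 522751255122491849164839,
    522651245122491749164840]⟩,
  ⟨13566061, 5164, [(13566063, 13566063, 0)],
   [5001, 51225121491949185206520148004809, 51215120491849175208520148004811,
    51295114510651014915, 49235122512152064805480252014924, 522851244923492251214827,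
    522751225120491949174830, 522651245123491949184832, 522851245120491949164833,
    522751235120491849164834, 522751255123491949174835, 522851255124491849174838,
    522751255122491849164839, 522651245122491749164840]⟩,
  ⟨13566062, 5172, [(13566063, 13566063, 0), (13566190, 13566190, 0)],
   [5000, 5007, 5128492349054903490251004908, 51285112511151004915,
    49235122512052074805480352014925, 522851254923492251204826, 522651225121491949184829,
    522651245123491949184832, 522751255123491949174835, 522851255121491949164836,
    522651235121491749164837, 522851255124491849174838, 522751255122491849164839,
    522651245122491749164840]⟩,
  ⟨102695018, 51755145, [(102695146, 102695086, 1)],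
   [5007, 4926512051085107510251014900, 5126492549064905490351004904,
    49255124511849175213520748064814, 51405109510751044915,
    4826512451205119511652125207480652055204480352024821,
    4826512251205119511752105207520648055204480352014823, 522649255124512149204827,
    522649255123512249204828, 522651225121491949184829, 522751225120491949174830,
    522851215120491849174831, 522651245123491949184832, 522851245120491949164833,
    522751235120491849164834, 522751255123491949174835, 522851255121491949164836,
    522651235121491749164837, 522851255124491849174838, 522751255122491849164839]⟩,
  ⟨3870962, 51685142, [(3871474, 3871474, 0)],
   [5009, 49215120511849175209520748064810, 51254921511949165209520448014813,
    51244920511949165210520448014814, 51265114510951004915,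
    5118511349125109490649045103490151004922, 51205118491648125209520748054923,
    53235122472147205319521852175116521552105209540554045203520246014228,
    512651094906490151004929, 522751225120491949174830, 5128512151204917511349125109510751034831,
    51255124512348215320481953175116521554115209540752064605520152004232,
    522851245120491949164833, 51245120511949165209520752044834, 522751255123491949174835,
    522851255121491949164836, 522651235121491749164837, 523151255124492149204838,
    522951244920511949164839, 522651245122491749164840]⟩,
  ⟨102695084, 51835153, [(102695086, 102695086, 0), (102695148, 102695086, 1232)],
   [5001, 5006, 4926512551065105510451034900, 51214920491851175210480752064809,
    51265114510951004915, 4826512251205119511752105207520648055204480352014823,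
    4826512551215119511652125208480752065203480252014824, 522649255124512149204827,
    522649255123512249204828, 522751225120491949174830, 522851215120491849174831,
    522651245123491949184832, 522851245120491949164833, 522751235120491849164834,
    522751255123491949174835, 522851255121491949164836, 522651235121491749164837,
    522851255124491849174838, 522751255122491849164839, 522651245122491749164840]⟩,
  ⟨8323164, 51355115, [(8323196, 8323196, 0), (8323676, 8323676, 0)],
   [5005, 5009, 51245123492249214806520552024801, 51234921491751165212480652054810,
    49225120511949175209520848064811, 51195112511051095108510451004915,
    51254722472153205219521851175316521552135212520852074606540554024226,
    49225121511951185209520852034827, 51224921511951185209520752044828, 522651225121491949184829,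
    522751225120491949174830, 522851215120491849174831,
    512551245123492249215120491949185117511652154632, 522851245120491949164833,
    522751235120491849164834, 512551245123492251214920491951184917511652154635,
    522851255121491949164836, 522651235121491749164837,
    512551245123512249214920511949184917511652154638, 522751255122491849164839,
    522651245122491749164840]⟩,
  ⟨4131042, 51685142, [(12519650, 8323676, 125432)],
   [5023, 51234920491851165212480752054809, 49215120511849175209520748064810,
    51254921511949165209520448014813, 51244920511949165210520448014814, 51265114510951004915,
    5119491151105109510849074906490151004922,
    51235122482148205319511851175316521552145213461152105209540554044228,
    522651225121491949184829, 522751225120491949174830, 522851215120491849174831,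
    522651245123491949184832, 522851245120491949164833, 522751235120491849164834,
    522751255123491949174835, 522851255121491949164836, 522651235121491749164837,
    512551245123512249214920511949184917511652154638, 522751255122491849164839,
    522651245122491749164840]⟩,
  ⟨4129010, 51685142, [(12517618, 8323196, 125432)],
   [5023, 51234920491851165212480752054809, 49215120511849175209520748064810,
    51254921511949165209520448014813, 51234920511849165211520348014814, 51265114510951004915,
    5123510849074906510549045103510249014922,
    53235122472147205319521852175116521552105209540554045203520246014228,
    522651225121491949184829, 522751225120491949174830, 522851215120491849174831,
    522651245123491949184832, 522851245120491949164833, 522751235120491849164834,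
    522751255123491949174835, 522851255121491949164836, 522651235121491749164837,
    512551245123512249214920511949184917511652154638, 522751255122491849164839,
    522651245122491749164840]⟩,
  ⟨4128828, 5142, [(4129084, 4129010, 1252), (8323132, 8323132, 0)],
   [5008, 5022, 51224921511949185212520448034813, 51224920511949175212520448024814,
    51265114510951004915, 51224921511951185209520752044828, 522651225121491949184829,
    522751225120491949174830, 522851215120491849174831, 522851245120491949164833,
    522851255121491949164836, 512551245123512249214920511949184917511652154638,
    522751255122491849164839, 522651245122491749164840]⟩,
  ⟨3867376, 5137, [(3871472, 3871472, 0), (3883760, 3870962, 2425)],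
   [5012, 5014, 51234921491751165212480652054810, 51385112510551044915,
    51214920511752104809480752064918, 49215120511851175211520752024826,
    51214920511851175211520652034827, 523149214920511851174828, 522751225120491949174830,
    522851245120491949164833, 522751255123491949174835, 522851255121491949164836,
    522651235121491749164837, 522651245122491749164840]⟩,
  ⟨4130844, 5142, [(4131100, 4131042, 1252), (8325148, 8323164, 1213543)],
   [5008, 5022, 51224921511949185212520448034813, 51224920511949175212520448024814,
    5234522651224920491949174815,
    51235122482148205319511851175316521552145213461152105209540554044228,
    522651225121491949184829, 522751225120491949174830, 522851215120491849174831,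
    522851245120491949164833, 522851255121491949164836,
    512551245123512249214920511949184917511652154638, 522751255122491849164839,
    522651245122491749164840]⟩,
  ⟨13565997, 5129, [(13566061, 13566061, 0)],
   [5006, 4923512251075106490551044903490251014908, 51255122491849165206520448004813,
    513551315129512749165113511051085106510351014715, 51254922511851165213520552034826,
    5122510751065104510149004928, 522651245123491949184832, 522851245120491949164833,
    522851255124491849174838, 522651245122491749164840]⟩,
  ⟨13566005, 5129, [(13566069, 13566059, 232454), (13566261, 13566061, 123542)],
   [5006, 5008, 51255122491849165206520448004813,
    513551315129512749165113511051085106510351014715, 51254922511851165213520552034826,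
    5122510751065104510149004928, 522651245123491949184832, 522851245120491949164833,
    522851255124491849174838, 522651245122491749164840]⟩,
  ⟨13566060, 51725164, [(13566061, 13566061, 0), (13566062, 13566062, 0)],
   [5000, 5001, 5128492349054903490251004908, 49235120491851165214480352014811,
    51315112510851014915, 49235122512152064805480252014924, 49235122512052074805480352014925,
    522851254923492251204826, 522851244923492251214827, 522651225121491949184829,
    522751225120491949174830, 522651245123491949184832, 522851245120491949164833,
    522751235120491849164834, 522751255123491949174835, 522851255121491949164836,
    522651235121491749164837, 522851255124491849174838, 522751255122491849164839,
    522651245122491749164840]⟩,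
  ⟨102694968, 5141, [(102695096, 102695018, 1235342)],
   [5007, 492551204919511851174916521152074805480452024812, 49255122511849165211520748054814,
    51265114510951004915, 48265125511951165212520552044921, 522649255124512149204827,
    522651225121491949184829, 522751225120491949174830, 522851215120491849174831,
    522751235120491849164834, 522751255123491949174835, 522851255121491949164836,
    522651235121491749164837, 522751255122491849164839]⟩,
  ⟨102694956, 5180, [(102695020, 102695018, 232), (102695084, 102695084, 0)],
   [5006, 5007, 4926512551065105510451034900, 51395110510651044915,
    4826512251205119511752105207520648055204480352014823, 522649255123512249204828,
    522851215120491849174831, 522651245123491949184832, 522851245120491949164833,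
    522751235120491849164834, 522751255123491949174835, 522851255121491949164836,
    522651235121491749164837, 522851255124491849174838]⟩,
  ⟨13566058, 51725169, [(13566059, 13566059, 0), (13566062, 13566062, 0), (13566186, 13566062, 1343)],
   [5000, 5002, 5007, 49235120511849165209520748054812, 51335111510751024915,
    51245123492248065205520248014921, 49235122512052074805480352014925, 522851254923492251204826,
    522851244923492251214827, 522651225121491949184829, 522751225120491949174830,
    522851215120491849174831, 522651245123491949184832, 522751235120491849164834,
    522751255123491949174835, 522851255121491949164836, 522651235121491749164837,
    522851255124491849174838, 522751255122491849164839, 522651245122491749164840]⟩,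
  ⟨4128994, 51385118, [(4129010, 4129010, 0), (4131042, 4131042, 0)],
   [5004, 5011, 51255124492149205205520448014808, 51254921511949165209520448014813,
    51234920511849165211520348014814, 51185113511151095107510351004915,
    51254921511951165212520552044826, 51214920511851175211520652034827,
    53235122472147205319521852175116521552105209540554045203520246014228,
    522651225121491949184829, 522751225120491949174830, 522851215120491849174831,
    522651245123491949184832, 522851245120491949164833, 522751235120491849164834,
    522751255123491949174835, 522851255121491949164836, 522651235121491749164837,
    512551245123512249214920511949184917511652154638, 522751255122491849164839,
    522651245122491749164840]⟩,
  ⟨3866866, 5137, [(3870962, 3870962, 0), (4129010, 4129010, 0)],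
   [5012, 5018, 49215120511849175209520748064810, 52344921492051184917480648014814,
    5234522949214920511849174815, 49215120511851175211520752024826,
    51214920511851175211520652034827, 523149214920511851174828, 522751225120491949174830,
    522851245120491949164833, 522751255123491949174835, 522851255121491949164836,
    522651235121491749164837, 522651245122491749164840]⟩,
  ⟨4128962, 5152, [(4128994, 4128994, 0)],
   [5005, 51234920491851165212480752054809, 49215120511849175209520748064810,
    51265114510951004915, 51245123492148065205520248014922,
    53235122472147205319521852175116521552105209540554045203520246014228,
    522651225121491949184829, 522751225120491949174830, 522851215120491849174831,
    522851245120491949164833, 522851255121491949164836,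
    512551245123512249214920511949184917511652154638, 522751255122491849164839,
    522651245122491749164840]⟩,
  ⟨4130828, 5158, [(4130844, 4130844, 0)],
   [5004, 51224921511949185212520448034813, 51224920511949175212520448024814,
    51305113510751014915, 51245119491848115210520448034923,
    51235122482148205319511851175316521552145213461152105209540554044228,
    522851215120491849174831, 522651245123491949184832, 522851245120491949164833,
    522751235120491849164834, 522751255123491949174835, 522851255121491949164836,
    522651235121491749164837, 512551245123512249214920511949184917511652154638]⟩,
  ⟨4128796, 5127, [(4128828, 4128828, 0), (4129052, 4128994, 1252), (4130844, 4130844, 0)],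
   [5005, 5008, 5011, 513551325131512849165112511151085105510351024715,
    49215120511851175211520752024826, 51214920511851175211520652034827, 522651225121491949184829,
    522751225120491949174830, 522751255122491849164839, 522651245122491749164840]⟩,
  ⟨13566001, 51365116, [(13566005, 13566005, 0), (13566065, 13566005, 1252)],
   [5002, 5006, 51225121491949185206520148004809, 51255121491949165206520348004812,
    51255122491849165206520448004813, 51225112511151075106510451014915,
    51254922511851165213520552034826, 49225121511951185209520852034827,
    5122510751065104510149004928, 522651225121491949184829, 522751225120491949174830,
    522851215120491849174831, 522651245123491949184832, 522851245120491949164833,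
    522751235120491849164834, 522751255123491949174835, 522851255121491949164836,
    522651235121491749164837, 522851255124491849174838, 522751255122491849164839,
    522651245122491749164840]⟩,
  ⟨13565989, 5124, [(13565997, 13565997, 0), (13566005, 13566005, 0)],
   [5003, 5004, 51245122491749165207520448004814,
    514051385136512949225114510951065105510451034715, 49225121511951185209520852034827,
    5123510851055103510249004928, 522751225120491949174830, 522851215120491849174831,
    522851245120491949164833, 522751235120491849164834]⟩,
  ⟨3866684, 5137, [(3867708, 3866866, 2451), (3870780, 3867376, 2451), (4128828, 4128828, 0)],
   [5010, 5012, 5018, 51224920511949175212520448024814, 5234522949214920511849174815,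
    49215120511851175211520752024826, 51214920511851175211520652034827, 523149214920511851174828,
    522751225120491949174830, 522851245120491949164833, 522751255123491949174835,
    522851255121491949164836, 522651235121491749164837, 522651245122491749164840]⟩,
  ⟨69140614, 53835275526152535248524653425134531852055604, [(102695046, 102694968, 235342)],
   [5025, 4926512551065105510451034900, 5126492049074902490151004908,
    48265125492051194918511751165212521048075206520552044809,
    512549205119491849175116521248075205520448024811,
    512549205119491851174916521048075206520448014813, 4926511951125110510851044914,
    51265114510951004915, 48265120511851175211520752024921,
    4926511951175210510849075102490151004922, 48265125511951175210520652044923,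
    4826512551215119511652125208480752065203480252014824, 51244920511951165212520552044827,
    51224920511951175210520652044828, 522651225121491949184829, 522751225120491949174830,
    522851215120491849174831, 522651245123491949184832, 522851245120491949164833,
    522751235120491849164834, 522751255123491949174835, 522851255121491949164836,
    522651235121491749164837, 522851255124491849174838, 522751255122491849164839,
    522651245122491749164840]⟩,
  ⟨102694952, 5142, [(102695208, 102694956, 1235342)],
   [5008, 492551205119491851174916521052084805480352024813, 49255121511949165210520848054814,
    51265114510951004915, 48265125511851165213520552034922, 522649255123512249204828,
    522651225121491949184829, 522751225120491949174830, 522851215120491849174831,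
    522851245120491949164833, 522851255121491949164836, 522851255124491849174838,
    522751255122491849164839, 522651245122491749164840]⟩,
  ⟨3866850, 5174, [(3866866, 3866866, 0), (4128994, 4128994, 0)],
   [5004, 5018, 51255124492149205205520448014808, 51234920511849165211520348014814,
    5234522949214920511849174815, 49215120511851175211520752024826,
    51214920511851175211520652034827, 523149214920511851174828, 522751225120491949174830,
    522851245120491949164833, 522751255123491949174835, 522851255121491949164836,
    522651235121491749164837, 522651245122491749164840]⟩,
  ⟨102694948, 5141, [(102695076, 102694956, 1232), (102699044, 102694956, 1213)],
   [5007, 5012, 49255122511849165211520748054814, 51335111510751024915,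
    48265125511951165212520552044921, 522649255124512149204827, 522651225121491949184829,
    522751225120491949174830, 522851215120491849174831, 522751235120491849164834,
    522751255123491949174835, 522851255121491949164836, 522651235121491749164837,
    522751255122491849164839]⟩,
  ⟨2031751, 5150, [(35586183, 13565997, 2432)],
   [5025, 5125492049075106510551045103490249014908, 5127512549184917490751055104490249004811,
    5128512549184916490751065104490149004813, 51305113510751014915, 5125510651055104510349004926,
    522651225121491949184829, 522651245123491949184832, 522751255123491949174835,
    522851255121491949164836, 522651235121491749164837, 522851255124491849174838,
    522751255122491849164839, 522651245122491749164840]⟩,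
  ⟨13565996, 5129, [(13566060, 13566060, 0), (282001452, 102694968, 3543)],
   [5006, 5028, 5128492349054903490251004908, 52284923512049184916480548034813,
    5139513551345130522952284922491749165113511051085106510351014515, 522851254923492251204826,
    522651245123491949184832, 522851245120491949164833, 522851255124491849174838,
    522651245122491749164840]⟩,
  ⟨13566004, 5176, [(13566005, 13566005, 0), (13566068, 13566058, 232454), (13566260, 13566060, 123542)],
   [5000, 5006, 5008, 51295114510651014915, 49235122512152064805480252014924,
    522851244923492251214827, 522751225120491949174830, 522651245123491949184832,
    522851245120491949164833, 522751235120491849164834, 522751255123491949174835,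
    522851255124491849174838, 522751255122491849164839, 522651245122491749164840]⟩,
  ⟨13565955, 5129, [(13566019, 13565989, 232454), (13566211, 13566001, 252)],
   [5006, 5008, 51235120491849165208520248004813,
    513951365131513049225113511051085106510351014715, 51254922511851165213520552034826,
    5122510751065104510149004928, 522651245123491949184832, 522851245120491949164833,
    522851255124491849174838, 522651245122491749164840]⟩,
  ⟨13566000, 51365116, [(13566004, 13566004, 0), (13566064, 13566004, 1252), (13566512, 13566004, 1512), (13574192, 13566004, 1215), (282001456, 102694948, 3543)],
   [5002, 5006, 5009, 5013, 5028, 49235120511849165209520748054812, 51285112511151004915,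
    522851254923492251204826, 522851244923492251214827, 522651225121491949184829,
    522751225120491949174830, 522851215120491849174831, 522651245123491949184832,
    522851245120491949164833, 522751235120491849164834, 522751255123491949174835,
    522851255121491949164836, 522651235121491749164837, 522851255124491849174838,
    522751255122491849164839, 522651245122491749164840]⟩,
  ⟨2031747, 5150, [(2032003, 2031751, 1235342), (35586179, 13565989, 2432)],
   [5008, 5025, 51215120491849175208520148004811, 5128512549184916490751065104490149004813,
    51305113510751014915, 5125510651055104510349004926, 522651225121491949184829,
    522651245123491949184832, 522751255123491949174835, 522851255121491949164836,
    522651235121491749164837, 522851255124491849174838, 522751255122491849164839,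
    522651245122491749164840]⟩,
  ⟨2031750, 5150, [(35586182, 13565996, 2432), (69140614, 69140614, 0)],
   [5025, 5026, 5126492049074902490151004908, 52265121492049184917480748024811,
    52265123492049184916480748014813, 523452335231523054265125472049194918491749164415,
    522651225121491949184829, 522651245123491949184832, 522751255123491949174835,
    522851255121491949164836, 522651235121491749164837, 522851255124491849174838,
    522751255122491849164839, 522651245122491749164840]⟩,
  ⟨13565988, 5124, [(13565996, 13565996, 0), (13566004, 13566004, 0), (282001444, 102694952, 3543)],
   [5003, 5004, 5028, 52284923512149174916480548024814,
    5139513751355232512952284923491749165114510951065105510451034515, 522851244923492251214827,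
    522751225120491949174830, 522851215120491849174831, 522851245120491949164833,
    522751235120491849164834]⟩,
  ⟨3866818, 51615147, [(3866850, 3866850, 0), (4128962, 4128962, 0)],
   [5005, 5018, 51255124492149205205520448014808, 49215120511849175209520748064810,
    51234920511849165211520348014814, 51325114510551024915, 51245123492148065205520248014922,
    51254921511951165212520552044826, 51214920511851175211520652034827,
    53235122472147205319521852175116521552105209540554045203520246014228,
    512651094906490151004929, 522751225120491949174830, 5129512351194917510951055104510349014831,
    522851245120491949164833, 522751255123491949174835, 522851255121491949164836,
    522651235121491749164837, 523151255124492149204838, 522951244920511949164839,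
    522651245122491749164840]⟩,
  ⟨102694914, 5149, [(102694978, 102694948, 232), (102703106, 102694952, 25134)],
   [5006, 5013, 4926511751115110510651024909, 51395110510651044915,
    48265125511951175210520652044923, 522649255123512249204828, 522851215120491849174831,
    522651245123491949184832, 522851245120491949164833, 522751235120491849164834,
    522751255123491949174835, 522851255121491949164836, 522651235121491749164837,
    522851255124491849174838]⟩,
  ⟨4128780, 51385118, [(4128796, 4128796, 0), (4129036, 4128962, 1252), (4130828, 4130828, 0)],
   [5004, 5008, 5011, 51224921511949185212520448034813, 51224920511949175212520448024814,
    51195112511051095108510451004915, 49215120511851175211520752024826,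
    51214920511851175211520652034827, 51224921511951185209520752044828, 522651225121491949184829,
    522751225120491949174830, 522851215120491849174831, 522651245123491949184832,
    522851245120491949164833, 522751235120491849164834, 522751255123491949174835,
    522851255121491949164836, 522651235121491749164837,
    512551245123512249214920511949184917511652154638, 522751255122491849164839,
    522651245122491749164840]⟩,
  ⟨3866652, 51615147, [(3866684, 3866684, 0), (3866908, 3866850, 1252), (3867676, 3866850, 2451), (4128796, 4128796, 0), (8060956, 4128796, 121454)],
   [5005, 5008, 5010, 5018, 5022, 51224920511949175212520448024814, 51345110510851024915,
    49215120511851175211520752024826, 51214920511851175211520652034827,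
    51224921511951185209520752044828, 51225120491951175211520752024829, 522751225120491949174830,
    51225120511949175209520752044831, 522851245120491949164833, 522751255123491949174835,
    522851255121491949164836, 522651235121491749164837, 523151255124492149204838,
    522951244920511949164839, 522651245122491749164840]⟩,
  ⟨69140610, 51795165514651175203, [(69140614, 69140614, 0), (69140866, 69140614, 1235342), (102695042, 102694952, 235342)],
   [5002, 5008, 5025, 4926512051085107510251014900, 4926511751115110510651024909,
    512549205119491851174916521048075206520448014813, 4926511951125110510851044914,
    51265114510951004915, 48265120511851175211520752024921,
    4926511951175210510849075102490151004922, 48265125511951175210520652044923,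
    48265125511851175211520652034924, 51214920511851175211520652034827,
    51224920511951175210520652044828, 522651225121491949184829, 522751225120491949174830,
    522851215120491849174831, 522651245123491949184832, 522851245120491949164833,
    522751235120491849164834, 522751255123491949174835, 522851255121491949164836,
    522651235121491749164837, 522851255124491849174838, 522751255122491849164839,
    522651245122491749164840]⟩,
  ⟨3866636, 5174, [(3866652, 3866652, 0), (3866892, 3866818, 1252), (4128780, 4128780, 0)],
   [5004, 5008, 5018, 51224920511949175212520448024814, 51295114510651014915,
    49215120511851175211520752024826, 51214920511851175211520652034827, 523149214920511851174828,
    522751225120491949174830, 522851245120491949164833, 522751255123491949174835,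
    522851255121491949164836, 522651235121491749164837, 522651245122491749164840]⟩,
  ⟨13565953, 5119, [(13565955, 13565955, 0), (13565957, 13565955, 232454)],
   [5001, 5002, 51225121491949185206520148004809,
    514051335131512949225114510951085107510251014715, 49225121511951185209520852034827,
    5122510751065104510149004928, 522751255123491949174835, 522851255121491949164836,
    522851255124491849174838, 522751255122491849164839]⟩,
  ⟨2031619, 5150, [(2031875, 2031747, 454), (35586051, 13565955, 3453)],
   [5008, 5025, 51215120491849175208520148004811, 51235120491849165208520248004813,
    51305113510751014915, 5125510651055104510349004926, 522651225121491949184829,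
    522651245123491949184832, 522751255123491949174835, 522851255121491949164836,
    522651235121491749164837, 522851255124491849174838, 522751255122491849164839,
    522651245122491749164840]⟩,
  ⟨2031746, 51725165, [(2031747, 2031747, 0), (2031750, 2031750, 0), (2032002, 2031750, 1235342), (35586178, 13565988, 2432), (69140610, 69140610, 0)],
   [5000, 5002, 5008, 5025, 5026, 52265123492049184916480748014813, 51265114510951004915,
    51255123492048075205520348014922, 51224920511951175210520652044828, 522651225121491949184829,
    522751225120491949174830, 522851215120491849174831, 522651245123491949184832,
    522851245120491949164833, 522751255123491949174835, 522851255121491949164836,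
    522651235121491749164837, 522851255124491849174838, 522751255122491849164839,
    522651245122491749164840]⟩,
  ⟨13565954, 5129, [(13566018, 13565988, 232454), (13566210, 13566000, 252), (13574146, 13565988, 154123), (282001410, 102694914, 3543)],
   [5006, 5008, 5013, 5028, 5139513551345130522952284922491749165113511051085106510351014515,
    522851254923492251204826, 522651245123491949184832, 522851245120491949164833,
    522851255124491849174838, 522651245122491749164840]⟩,
  ⟨69140482, 5187514251175203, [(69140610, 69140610, 0), (69140738, 69140610, 454), (102694914, 102694914, 0)],
   [5007, 5008, 5025, 4926512551065105510451034900, 4926511951125110510851044914,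
    51265114510951004915, 48265120511851175211520752024921, 48265120511951175210520852024922,
    48265125511951175210520652044923, 48265125511851175211520652034924,
    51214920511851175211520652034827, 51224920511951175210520652044828, 522651225121491949184829,
    522751225120491949174830, 522851215120491849174831, 522651245123491949184832,
    522851245120491949164833, 522751235120491849164834, 522751255123491949174835,
    522851255121491949164836, 522651235121491749164837, 522851255124491849174838,
    522751255122491849164839, 522651245122491749164840]⟩,
  ⟨102694912, 5141, [(102695040, 102694914, 1235342), (102699008, 102694914, 35124)],
   [5007, 5012, 4926511951125110510851044914, 51405109510751044915,
    48265125511951165212520552044921, 522649255124512149204827, 522651225121491949184829,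
    522751225120491949174830, 522851215120491849174831, 522751235120491849164834,
    522751255123491949174835, 522851255121491949164836, 522651235121491749164837,
    522751255122491849164839]⟩,
  ⟨2031618, 5172, [(2031619, 2031619, 0), (2031746, 2031746, 0), (2031874, 2031746, 454), (35586050, 13565954, 3453), (69140482, 69140482, 0)],
   [5000, 5007, 5008, 5025, 5026, 523452335231523054265125472049194918491749164415,
    522651225121491949184829, 522651245123491949184832, 522751255123491949174835,
    522851255121491949164836, 522651235121491749164837, 522851255124491849174838,
    522751255122491849164839, 522651245122491749164840]⟩,
  ⟨2031617, 5150, [(2031873, 2031619, 125342), (35586049, 13565953, 3453)],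
   [5008, 5025, 51255124491849175205520448004811, 51255122491849165206520448004813,
    51285112511151004915, 5125510651055104510349004926, 522651225121491949184829,
    522651245123491949184832, 522751255123491949174835, 522851255121491949164836,
    522651235121491749164837, 522851255124491849174838, 522751255122491849164839,
    522651245122491749164840]⟩,
  ⟨13565952, 5119, [(13565954, 13565954, 0), (13565956, 13565954, 232454), (13566464, 13565954, 154123), (282001408, 102694912, 3543)],
   [5001, 5002, 5009, 5028, 5140513451325130522952284922491749165114510951085107510251014515,
    522851244923492251214827, 522751255123491949174835, 522851255121491949164836,
    522851255124491849174838, 522751255122491849164839]⟩,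
  ⟨69140480, 51845175516851535116511552065205, [(69140482, 69140482, 0), (69140484, 69140482, 232), (102694912, 102694912, 0)],
   [5001, 5002, 5025, 4926512551065105510451034900, 4926511651135112510551014909,
    51265114510951004915, 48265120511851175211520752024921, 48265120511951175210520852024922,
    48265125511951175210520652044923, 48265125511851175211520652034924,
    51214920511851175211520652034827, 51234920511851165213520552034828, 522651225121491949184829,
    522751225120491949174830, 522851215120491849174831, 522651245123491949184832,
    522851245120491949164833, 522751235120491849164834, 522751255123491949174835,
    522851255121491949164836, 522651235121491749164837, 522851255124491849174838,
    522751255122491849164839, 522651245122491749164840]⟩,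
  ⟨3866628, 5124, [(3866636, 3866636, 0), (3866644, 3866636, 121454)],
   [5003, 5004, 51224920511949175212520448024814,
    513851355129512649165114510951065105510451034715, 51214920511851175211520652034827,
    51224921511951185209520752044828, 522751225120491949174830, 51225120511949175209520752044831,
    522851245120491949164833, 5132512151194916510951065104510349024834]⟩,
  ⟨68616192, 5104, [(69140480, 69140480, 0), (102170624, 69140480, 153142)],
   [5019, 5025, 48265120511951175210520852024922, 48265125511851175211520652034924,
    522851255124491849174838, 522751255122491849164839, 522651245122491749164840]⟩,
  ⟨2031616, 5172, [(2031617, 2031617, 0), (2031744, 2031618, 1235342), (2031872, 2031618, 125342), (35586048, 13565952, 3453), (69140480, 69140480, 0)],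
   [5000, 5007, 5008, 5025, 5026, 523452335231523054265125472049194918491749164415,
    522651225121491949184829, 522651245123491949184832, 522751255123491949174835,
    522851255121491949164836, 522651235121491749164837, 522851255124491849174838,
    522751255122491849164839, 522651245122491749164840]⟩,
  ⟨3866624, 51365116, [(3866628, 3866628, 0), (3866688, 3866628, 1252), (3867136, 3866628, 2451), (3870720, 3866628, 4125), (3874816, 3866628, 2425)],
   [5002, 5006, 5009, 5012, 5013, 51195112511051095108510451004915,
    51254921511951165212520552044826, 51214920511851175211520652034827,
    51224921511951185209520752044828, 51225120491951175211520752024829, 522751225120491949174830,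
    51225120511949175209520752044831, 51245120491951165213520752014832, 522851245120491949164833,
    51245120511949165209520752044834, 522751255123491949174835, 522851255121491949164836,
    522651235121491749164837, 523151255124492149204838, 522951244920511949164839,
    522651245122491749164840]⟩,
  ⟨983041, 51575148, [(3080193, 2031617, 343), (17760257, 2031617, 23542)],
   [5021, 5024, 51225121491949185206520148004809, 51255124491849175205520448004811,
    51255121491949165206520348004812, 51245122491749165207520448004814, 51285112511151004915,
    5124510751055104510249004927, 522651225121491949184829, 522751225120491949174830,
    522851215120491849174831, 522651245123491949184832, 522851245120491949164833,
    522751235120491849164834, 522751255123491949174835, 522851255121491949164836,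
    522651235121491749164837, 522851255124491849174838, 522751255122491849164839,
    522651245122491749164840]⟩,
  ⟨67567616, 511851085104, [(68616192, 68616192, 0), (101122048, 68616192, 1)],
   [5020, 5025, 4926512551065105510451034900, 51265114510951004915,
    48265125511951165212520552044921, 48265125511851165213520552034922,
    48265125511951175210520652044923, 48265120511951165212520852014924,
    51215120491851175210520852024829, 5129512749265120511849175109510851034830,
    522851215120491849174831, 51255124491851175210520652044832,
    5132512849265120511849165109510851034833, 522751235120491849164834,
    5132512749265125511849175109510751044835, 5129512849265125511849165109510751044836,
    522651235121491749164837, 522851255124491849174838, 522751255122491849164839,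
    522651245122491749164840]⟩,
  ⟨983040, 511851085104, [(983041, 983041, 0), (2031616, 2031616, 0), (3080192, 2031616, 343), (5177344, 2031616, 3543), (9371648, 2031616, 2342), (17760256, 2031616, 23542), (34537472, 2031616, 235342)],
   [5000, 5020, 5021, 5022, 5023, 5024, 5025, 51265114510951004915, 522651225121491949184829,
    522751225120491949174830, 522851215120491849174831, 522651245123491949184832,
    522851245120491949164833, 522751235120491849164834, 522751255123491949174835,
    522851255121491949164836, 522651235121491749164837, 522851255124491849174838,
    522751255122491849164839, 522651245122491749164840]⟩,
  ⟨1507328, 5104, [(2031616, 2031616, 0), (5701632, 3866624, 454), (18284544, 3866624, 232454), (35061760, 2031616, 153142)],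
   [5019, 5022, 5024, 5025, 522851255124491849174838, 522751255122491849164839,
    522651245122491749164840]⟩,
  ⟨67436544, 5110, [(67567616, 67567616, 0), (67960832, 67567616, 235342)],
   [5017, 5019, 48265120511851175211520752024921, 48265120511951165212520852014924,
    492651195116521251085105510451014927, 522751235120491849164834, 522751255122491849164839]⟩,
  ⟨67305472, 5103, [(67567616, 67567616, 0), (100859904, 67567616, 1514)],
   [5018, 5025, 48265120511851175211520752024921, 48265125511951175210520652044923,
    5132512749265125511849175109510751044835, 5129512849265125511849165109510751044836,
    522651235121491749164837]⟩,
  ⟨458752, 5104, [(983040, 983040, 0), (4653056, 1507328, 12342), (17235968, 1507328, 1343), (34013184, 1507328, 1)],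
   [5019, 5022, 5024, 5025, 522851255124491849174838, 522751255122491849164839,
    522651245122491749164840]⟩,
  ⟨67174400, 5103, [(67436544, 67436544, 0), (100728832, 67436544, 43152)],
   [5018, 5025, 48265120511851175211520752024921, 48265120511851165213520752014923,
    5127492651255110510651044935, 5129512849265125511849165109510751044836,
    51255121511949165210520652044837]⟩,
  ⟨196608, 5109, [(458752, 458752, 0), (720896, 458752, 454), (1245184, 458752, 43215), (33751040, 458752, 151432), (67305472, 67305472, 0)],
   [5018, 5019, 5020, 5025, 5026, 522651235121491749164837, 522651245122491749164840]⟩,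
  ⟨65536, 5102, [(196608, 196608, 0), (1114112, 196608, 121), (8454144, 196608, 123543), (16842752, 196608, 12343), (4295032832, 67174400, 12)],
   [5017, 5020, 5023, 5024, 5032, 51245122511749165210520652044833,
    51245120511949165209520752044834]⟩,
  ⟨67108864, 5101, [(67174400, 67174400, 0), (68157440, 67174400, 1312)],
   [5016, 5020, 48265120511851175211520752024921, 48265120511951175210520852024922,
    492651255116511351125205510451034929, 482651205118511651155112511151085105510351024830,
    482651205119511651155113511051075105510451024831]⟩,
  ⟨0, 5100, [(65536, 65536, 0), (131072, 65536, 232), (262144, 65536, 2432), (524288, 65536, 25432), (67108864, 67108864, 0), (134217728, 67108864, 343), (268435456, 67108864, 3543)],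
   [5016, 5017, 5018, 5019, 5026, 5027, 5028]⟩]

theorem checkSteps_pullSteps : checkSteps [2 ^ 15] pullSteps = true := by
  decide +kernel

theorem eval_facet_eq_apply {e : ℕ} (he : e < 16) (x : ℕ → ℝ) : eval (facet e) x = x e := by
  have h : ∀ e < 16, ∀ i ∈ range 16, facet e i = if e = i then 1 else 0 := by decide +kernel
  rw [eval_congr (h e he)]
  simp [eval, he]

/-- The face `t = 0` is the origin. -/
theorem faceGenerated_two_pow : FaceGenerated (2 ^ 15) := by
  have hc : ∀ e ∈ range 15, ∃ k < 41, facet k e = -1 ∧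
      ∀ i ∈ range 15, facet k i ≤ 0 := by decide +kernel
  intro x hx ht
  have h15 : x 15 = 0 := by
    rw [← eval_facet_eq_apply (e := 15) (by norm_num) x]
    exact ht 15 (by norm_num) (by decide)
  have hnonneg : ∀ e < 16, 0 ≤ x e := fun e he => by
    rw [← eval_facet_eq_apply he x]
    exact hx e (by omega)
  have hzero : ∀ e ∈ range 16, x e = 0 := fun e he => by
    rcases (Nat.lt_succ_iff.1 (Finset.mem_range.1 he)).eq_or_lt with rfl | he
    · exact h15
    obtain ⟨k, hk, hke, hki⟩ := hc e (Finset.mem_range.2 he)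
    have hle : eval (facet k) x ≤ (facet k e : ℝ) * x e := by
      rw [eval, Finset.sum_range_succ, h15, mul_zero, add_zero,
        ← Finset.add_sum_erase _ _ (Finset.mem_range.2 he)]
      refine add_le_of_nonpos_right (Finset.sum_nonpos fun i hi => ?_)
      have hi := Finset.mem_of_mem_erase hi
      exact mul_nonpos_of_nonpos_of_nonneg (by exact_mod_cast hki i hi)
        (hnonneg i (by have := Finset.mem_range.1 hi; omega))
    have := (hx k hk).trans hle
    rw [hke] at this
    push_cast at this
    exact le_antisymm (by linarith) (hnonneg e (by omega))
  intro y _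
  rw [Finset.sum_eq_zero fun e he => by rw [hzero e he, zero_mul]]

/-- Every vector of the weight cone is generated. -/
theorem Feasible.generated {x : ℕ → ℝ} (hx : Feasible x) : Generated x :=
  faceGenerated_zero_of_checkSteps (by simpa using faceGenerated_two_pow) checkSteps_pullSteps
    x hx fun k _ h => by simp at h

/-! ### The divisor inequalities -/

/-- The weights attached to a linear form with value `H` on `bH`, `e i` on `bE i` and `f i j` on
`bEE i j`. -/
noncomputable def formWeights (H : ℝ) (e : Fin 5 → ℝ) (f : Fin 5 → Fin 5 → ℝ) : ℕ → ℝ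
  | 0 => H - e 2 - e 3 - e 4 - f 2 3 - f 2 4 - f 3 4
  | 1 => H - e 1 - e 3 - e 4 - f 1 3 - f 1 4 - f 3 4
  | 2 => H - e 1 - e 2 - e 4 - f 1 2 - f 1 4 - f 2 4
  | 3 => H - e 1 - e 2 - e 3 - f 1 2 - f 1 3 - f 2 3
  | 4 => e 0
  | 5 => H - e 0 - e 3 - e 4 - f 0 3 - f 0 4 - f 3 4
  | 6 => H - e 0 - e 2 - e 4 - f 0 2 - f 0 4 - f 2 4
  | 7 => H - e 0 - e 2 - e 3 - f 0 2 - f 0 3 - f 2 3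
  | 8 => e 1
  | 9 => H - e 0 - e 1 - e 4 - f 0 1 - f 0 4 - f 1 4
  | 10 => H - e 0 - e 1 - e 3 - f 0 1 - f 0 3 - f 1 3
  | 11 => e 2
  | 12 => H - e 0 - e 1 - e 2 - f 0 1 - f 0 2 - f 1 2
  | 13 => e 3
  | 14 => e 4
  | 15 => 4 * H - 2 * e 0 - 2 * e 1 - 2 * e 2 - 2 * e 3 - 2 * e 4 -
      f 0 1 - f 0 2 - f 0 3 - f 0 4 - f 1 2 -
      f 1 3 - f 1 4 - f 2 3 - f 2 4 - f 3 4
  | _ => 0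

/-- Twice the coordinates, dual to `formWeights`, of a divisor class. -/
noncomputable def divisorWeights (d : ℝ) (m : Fin 5 → ℝ) (mm : Fin 5 → Fin 5 → ℝ) : ℕ → ℝ
  | 0 => mm 0 1 + mm 2 3 + mm 2 4 + mm 3 4 - d
  | 1 => mm 0 2 + mm 1 3 + mm 1 4 + mm 3 4 - d
  | 2 => mm 0 3 + mm 1 2 + mm 1 4 + mm 2 4 - d
  | 3 => mm 0 4 + mm 1 2 + mm 1 3 + mm 2 3 - d
  | 4 => mm 0 1 + mm 0 2 + mm 0 3 + mm 0 4 - 2 * m 0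
  | 5 => mm 1 2 + mm 0 3 + mm 0 4 + mm 3 4 - d
  | 6 => mm 1 3 + mm 0 2 + mm 0 4 + mm 2 4 - d
  | 7 => mm 1 4 + mm 0 2 + mm 0 3 + mm 2 3 - d
  | 8 => mm 0 1 + mm 1 2 + mm 1 3 + mm 1 4 - 2 * m 1
  | 9 => mm 2 3 + mm 0 1 + mm 0 4 + mm 1 4 - d
  | 10 => mm 2 4 + mm 0 1 + mm 0 3 + mm 1 3 - d
  | 11 => mm 0 2 + mm 1 2 + mm 2 3 + mm 2 4 - 2 * m 2
  | 12 => mm 3 4 + mm 0 1 + mm 0 2 + mm 1 2 - d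
  | 13 => mm 0 3 + mm 1 3 + mm 2 3 + mm 3 4 - 2 * m 3
  | 14 => mm 0 4 + mm 1 4 + mm 2 4 + mm 3 4 - 2 * m 4
  | 15 => 3 * d - mm 0 1 - mm 0 2 - mm 0 3 - mm 0 4 - mm 1 2 -
      mm 1 3 - mm 1 4 - mm 2 3 - mm 2 4 - mm 3 4
  | _ => 0

theorem sum_formWeights_mul_divisorWeights (H d : ℝ) (e m : Fin 5 → ℝ)
    (f mm : Fin 5 → Fin 5 → ℝ) :
    ∑ k ∈ range 16, formWeights H e f k * divisorWeights d m mm k =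
      2 * (d * H - ∑ i, m i * e i - ∑ p : PairIdx, mm p.1.1 p.1.2 * f p.1.1 p.1.2) := by
  rw [sum_pairIdx fun i j => mm i j * f i j]
  simp only [Finset.sum_range_succ, Finset.sum_range_zero, Fin.sum_univ_five, formWeights,
    divisorWeights]
  ring

/-- The coordinates in the positive and in the negative mask of a form. -/
def supports (p : ℕ × ℕ) : List ℕ × List ℕ :=
  ((List.range 16).filter fun e => p.1.testBit e, (List.range 16).filter fun e => p.2.testBit e)

theorem eval_coeffs (p : ℕ × ℕ) (x : ℕ → ℝ) :
    eval (coeffs p) x = ((supports p).1.map x).sum - ((supports p).2.map x).sum := by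
  have key : ∀ l : List ℕ, (l.map fun e => (coeffs p e : ℝ) * x e).sum =
      ((l.filter fun e => p.1.testBit e).map x).sum -
        ((l.filter fun e => p.2.testBit e).map x).sum := by
    intro l
    induction l with
    | nil => simp
    | cons e l ih =>
      rw [List.map_cons, List.sum_cons, ih, List.filter_cons, List.filter_cons]
      unfold coeffs
      split_ifs <;> simp <;> ring
  rw [supports, ← key, eval]
  simp [List.range_succ, Finset.sum_range_succ, add_assoc]

theorem eval_coeffs_nonneg {T : List (ℕ × ℕ)} {L : List (List ℕ × List ℕ)}
    (hL : T.map supports = L) {x : ℕ → ℝ} (h : ∀ q ∈ L, (q.2.map x).sum ≤ (q.1.map x).sum)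
    {k : ℕ} (hk : k < T.length) : 0 ≤ eval (coeffs (T.getD k (0, 0))) x := by
  rw [eval_coeffs, sub_nonneg, List.getD_eq_getElem _ _ hk]
  exact h _ (hL ▸ List.mem_map_of_mem (List.getElem_mem hk))

theorem map_supports_facetTable : facetTable.map supports = [
    ([0], []), ([1], []), ([2], []), ([3], []), ([4], []), ([5], []), ([6], []), ([7], []),
    ([8], []), ([9], []), ([10], []), ([11], []), ([12], []), ([13], []), ([14], []), ([15], []),
    ([15], [0, 1, 5, 12, 13, 14]), ([15], [0, 2, 6, 10, 11, 14]), ([15], [0, 3, 7, 9, 11, 13]),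
    ([15], [0, 4, 8, 9, 10, 12]), ([15], [1, 2, 7, 8, 9, 14]), ([15], [1, 3, 6, 8, 10, 13]),
    ([15], [1, 4, 6, 7, 11, 12]), ([15], [2, 3, 5, 8, 11, 12]), ([15], [2, 4, 5, 7, 10, 13]),
    ([15], [3, 4, 5, 6, 9, 14]), ([15], [0, 9, 14]), ([15], [0, 10, 13]), ([15], [0, 11, 12]),
    ([15], [1, 6, 14]), ([15], [1, 7, 13]), ([15], [1, 8, 12]), ([15], [2, 5, 14]),
    ([15], [2, 7, 11]), ([15], [2, 8, 10]), ([15], [3, 5, 13]), ([15], [3, 6, 11]),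
    ([15], [3, 8, 9]), ([15], [4, 5, 12]), ([15], [4, 6, 10]), ([15], [4, 7, 9])] := by
  decide +kernel

theorem map_supports_genTable : genTable.map supports = [
    ([], [0]), ([], [1]), ([], [2]), ([], [3]), ([], [4]), ([], [5]), ([], [6]), ([], [7]),
    ([], [8]), ([], [9]), ([], [10]), ([], [11]), ([], [12]), ([], [13]), ([], [14]),
    ([0, 1, 5, 15], []), ([0, 2, 6, 15], []), ([0, 3, 7, 15], []), ([0, 4, 8, 15], []),
    ([1, 2, 9, 15], []), ([1, 3, 10, 15], []), ([1, 4, 11, 15], []), ([2, 3, 12, 15], []),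
    ([2, 4, 13, 15], []), ([3, 4, 14, 15], []), ([5, 6, 9, 15], []), ([5, 7, 10, 15], []),
    ([5, 8, 11, 15], []), ([6, 7, 12, 15], []), ([6, 8, 13, 15], []), ([7, 8, 14, 15], []),
    ([9, 10, 12, 15], []), ([9, 11, 13, 15], []), ([10, 11, 14, 15], []), ([12, 13, 14, 15], []),
    ([9, 10, 11, 15], [0]), ([9, 12, 13, 15], [0]), ([10, 12, 14, 15], [0]),
    ([11, 13, 14, 15], [0]), ([6, 7, 8, 15], [1]), ([6, 12, 13, 15], [1]), ([7, 12, 14, 15], [1]),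
    ([8, 13, 14, 15], [1]), ([5, 7, 8, 15], [2]), ([5, 10, 11, 15], [2]), ([7, 10, 14, 15], [2]),
    ([8, 11, 14, 15], [2]), ([5, 6, 8, 15], [3]), ([5, 9, 11, 15], [3]), ([6, 9, 13, 15], [3]),
    ([8, 11, 13, 15], [3]), ([5, 6, 7, 15], [4]), ([5, 9, 10, 15], [4]), ([6, 9, 12, 15], [4]),
    ([7, 10, 12, 15], [4]), ([2, 3, 4, 15], [5]), ([2, 12, 13, 15], [5]), ([3, 12, 14, 15], [5]),
    ([4, 13, 14, 15], [5]), ([1, 3, 4, 15], [6]), ([1, 10, 11, 15], [6]), ([3, 10, 14, 15], [6]),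
    ([4, 11, 14, 15], [6]), ([1, 2, 4, 15], [7]), ([1, 9, 11, 15], [7]), ([2, 9, 13, 15], [7]),
    ([4, 11, 13, 15], [7]), ([1, 2, 3, 15], [8]), ([1, 9, 10, 15], [8]), ([2, 9, 12, 15], [8]),
    ([3, 10, 12, 15], [8]), ([0, 3, 4, 15], [9]), ([0, 7, 8, 15], [9]), ([3, 7, 14, 15], [9]),
    ([4, 8, 14, 15], [9]), ([0, 2, 4, 15], [10]), ([0, 6, 8, 15], [10]), ([2, 6, 13, 15], [10]),
    ([4, 8, 13, 15], [10]), ([0, 2, 3, 15], [11]), ([0, 6, 7, 15], [11]), ([2, 6, 12, 15], [11]),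
    ([3, 7, 12, 15], [11]), ([0, 1, 4, 15], [12]), ([0, 5, 8, 15], [12]), ([1, 5, 11, 15], [12]),
    ([4, 8, 11, 15], [12]), ([0, 1, 3, 15], [13]), ([0, 5, 7, 15], [13]), ([1, 5, 10, 15], [13]),
    ([3, 7, 10, 15], [13]), ([0, 1, 2, 15], [14]), ([0, 5, 6, 15], [14]), ([1, 5, 9, 15], [14]),
    ([2, 6, 9, 15], [14])] := by
  decide +kernel

theorem feasible_formWeights {H : ℝ} {e : Fin 5 → ℝ} {f : Fin 5 → Fin 5 → ℝ}
    (hs : ∀ i j, f i j = f j i) (hE : ∀ i, 0 ≤ e i) (hF : ∀ i j, i ≠ j → 0 ≤ f i j)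
    (hD : ∀ i j k, [i, j, k].Nodup → e i + e j + e k + f i j + f i k + f j k ≤ H)
    (hK : ∀ i j k h, [i, j, k, h].Nodup →
      e 0 + e 1 + e 2 + e 3 + e 4 + f i k + f i h + f j k + f j h ≤ 2 * H) :
    Feasible (formWeights H e f) := by
  refine fun k hk => eval_coeffs_nonneg map_supports_facetTable ?_ hk
  simp only [List.forall_mem_cons, List.map_cons, List.map_nil, List.sum_cons, List.sum_nil,
    formWeights]
  exact ⟨
    by linarith [hD 2 3 4 (by decide)],
    by linarith [hD 1 3 4 (by decide)],
    by linarith [hD 1 2 4 (by decide)],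
    by linarith [hD 1 2 3 (by decide)],
    by linarith [hE 0],
    by linarith [hD 0 3 4 (by decide)],
    by linarith [hD 0 2 4 (by decide)],
    by linarith [hD 0 2 3 (by decide)],
    by linarith [hE 1],
    by linarith [hD 0 1 4 (by decide)],
    by linarith [hD 0 1 3 (by decide)],
    by linarith [hE 2],
    by linarith [hD 0 1 2 (by decide)],
    by linarith [hE 3],
    by linarith [hE 4],
    by linarith [hD 0 1 2 (by decide), hD 0 3 4 (by decide), hD 1 3 4 (by decide),
      hD 2 3 4 (by decide), hE 3, hE 4, hF 3 4 (by decide)],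
    by linarith [hF 3 4 (by decide)],
    by linarith [hF 2 4 (by decide)],
    by linarith [hF 2 3 (by decide)],
    by linarith [hF 0 1 (by decide)],
    by linarith [hF 1 4 (by decide)],
    by linarith [hF 1 3 (by decide)],
    by linarith [hF 0 2 (by decide)],
    by linarith [hF 1 2 (by decide)],
    by linarith [hF 0 3 (by decide)],
    by linarith [hF 0 4 (by decide)],
    by linarith [hK 0 1 2 3 (by decide)],
    by linarith [hK 0 1 2 4 (by decide)],
    by linarith [hK 0 1 3 4 (by decide)],
    by linarith [hK 0 2 1 3 (by decide), hs 2 1],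
    by linarith [hK 0 2 1 4 (by decide), hs 2 1],
    by linarith [hK 0 2 3 4 (by decide)],
    by linarith [hK 0 3 1 2 (by decide), hs 3 1, hs 3 2],
    by linarith [hK 0 3 1 4 (by decide), hs 3 1],
    by linarith [hK 0 3 2 4 (by decide), hs 3 2],
    by linarith [hK 0 4 1 2 (by decide), hs 4 1, hs 4 2],
    by linarith [hK 0 4 1 3 (by decide), hs 4 1, hs 4 3],
    by linarith [hK 0 4 2 3 (by decide), hs 4 2, hs 4 3],
    by linarith [hK 1 2 3 4 (by decide)],
    by linarith [hK 1 3 2 4 (by decide), hs 3 2],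
    by linarith [hK 1 4 2 3 (by decide), hs 4 2, hs 4 3],
    by simp⟩

theorem eval_gen_divisorWeights_nonneg {d : ℝ} {m : Fin 5 → ℝ} {mm : Fin 5 → Fin 5 → ℝ}
    (hs : ∀ i j, mm i j = mm j i) (h : BoundaryIneqs d m mm) {k : ℕ} (hk : k < 95) :
    0 ≤ eval (gen k) (divisorWeights d m mm) := by
  obtain ⟨h1, h2, h3, h4, h5, h6, h7⟩ := h
  replace h2 : ∀ i, ∑ j, mm i j ≤ 2 * m i + mm i i := fun i => by
    rw [← Finset.sum_filter_add_sum_filter_not univ (fun j => j ≠ i)]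
    simpa [Finset.filter_eq'] using h2 i
  simp only [Fin.sum_univ_five] at h2
  refine eval_coeffs_nonneg map_supports_genTable ?_ hk
  simp only [List.forall_mem_cons, List.map_cons, List.map_nil, List.sum_cons, List.sum_nil,
    divisorWeights]
  exact ⟨
    by linarith [h5 2 3 4 0 1 (by decide)],
    by linarith [h5 1 3 4 0 2 (by decide)],
    by linarith [h5 1 2 4 0 3 (by decide)],
    by linarith [h5 1 2 3 0 4 (by decide)],
    by linarith [h2 0],
    by linarith [h5 0 3 4 1 2 (by decide)],
    by linarith [h5 0 2 4 1 3 (by decide)],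
    by linarith [h5 0 2 3 1 4 (by decide)],
    by linarith [h2 1, hs 1 0],
    by linarith [h5 0 1 4 2 3 (by decide)],
    by linarith [h5 0 1 3 2 4 (by decide)],
    by linarith [h2 2, hs 2 0, hs 2 1],
    by linarith [h5 0 1 2 3 4 (by decide)],
    by linarith [h2 3, hs 3 0, hs 3 1, hs 3 2],
    by linarith [h2 4, hs 4 0, hs 4 1, hs 4 2, hs 4 3],
    by linarith [h6 3 4 (by decide)],
    by linarith [h6 2 4 (by decide)],
    by linarith [h6 2 3 (by decide)],
    by linarith [h7 0 1 (by decide)],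
    by linarith [h6 1 4 (by decide)],
    by linarith [h6 1 3 (by decide)],
    by linarith [h7 0 2 (by decide)],
    by linarith [h6 1 2 (by decide)],
    by linarith [h7 0 3 (by decide)],
    by linarith [h7 0 4 (by decide)],
    by linarith [h6 0 4 (by decide)],
    by linarith [h6 0 3 (by decide)],
    by linarith [h7 1 2 (by decide)],
    by linarith [h6 0 2 (by decide)],
    by linarith [h7 1 3 (by decide)],
    by linarith [h7 1 4 (by decide)],
    by linarith [h6 0 1 (by decide)],
    by linarith [h7 2 3 (by decide)],
    by linarith [h7 2 4 (by decide)],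
    by linarith [h7 3 4 (by decide)],
    by linarith [h3 2 3 4 (by decide) (by decide) (by decide)],
    by linarith [h3 3 2 4 (by decide) (by decide) (by decide)],
    by linarith [h3 4 2 3 (by decide) (by decide) (by decide)],
    by linarith [h4 2 3 4 0 1 (by decide)],
    by linarith [h3 1 3 4 (by decide) (by decide) (by decide)],
    by linarith [h3 3 1 4 (by decide) (by decide) (by decide)],
    by linarith [h3 4 1 3 (by decide) (by decide) (by decide)],
    by linarith [h4 1 3 4 0 2 (by decide)],
    by linarith [h3 1 2 4 (by decide) (by decide) (by decide)],
    by linarith [h3 2 1 4 (by decide) (by decide) (by decide)],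
    by linarith [h3 4 1 2 (by decide) (by decide) (by decide)],
    by linarith [h4 1 2 4 0 3 (by decide)],
    by linarith [h3 1 2 3 (by decide) (by decide) (by decide)],
    by linarith [h3 2 1 3 (by decide) (by decide) (by decide)],
    by linarith [h3 3 1 2 (by decide) (by decide) (by decide)],
    by linarith [h4 1 2 3 0 4 (by decide)],
    by linarith [h1 0 1 (by decide)],
    by linarith [h1 0 2 (by decide)],
    by linarith [h1 0 3 (by decide)],
    by linarith [h1 0 4 (by decide)],
    by linarith [h3 0 3 4 (by decide) (by decide) (by decide)],
    by linarith [h3 3 0 4 (by decide) (by decide) (by decide)],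
    by linarith [h3 4 0 3 (by decide) (by decide) (by decide)],
    by linarith [h4 0 3 4 1 2 (by decide)],
    by linarith [h3 0 2 4 (by decide) (by decide) (by decide)],
    by linarith [h3 2 0 4 (by decide) (by decide) (by decide)],
    by linarith [h3 4 0 2 (by decide) (by decide) (by decide)],
    by linarith [h4 0 2 4 1 3 (by decide)],
    by linarith [h3 0 2 3 (by decide) (by decide) (by decide)],
    by linarith [h3 2 0 3 (by decide) (by decide) (by decide)],
    by linarith [h3 3 0 2 (by decide) (by decide) (by decide)],
    by linarith [h4 0 2 3 1 4 (by decide)],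
    by linarith [h1 1 0 (by decide), hs 1 0],
    by linarith [h1 1 2 (by decide)],
    by linarith [h1 1 3 (by decide)],
    by linarith [h1 1 4 (by decide)],
    by linarith [h3 0 1 4 (by decide) (by decide) (by decide)],
    by linarith [h3 1 0 4 (by decide) (by decide) (by decide)],
    by linarith [h3 4 0 1 (by decide) (by decide) (by decide)],
    by linarith [h4 0 1 4 2 3 (by decide)],
    by linarith [h3 0 1 3 (by decide) (by decide) (by decide)],
    by linarith [h3 1 0 3 (by decide) (by decide) (by decide)],
    by linarith [h3 3 0 1 (by decide) (by decide) (by decide)],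
    by linarith [h4 0 1 3 2 4 (by decide)],
    by linarith [h1 2 0 (by decide), hs 2 0],
    by linarith [h1 2 1 (by decide), hs 2 1],
    by linarith [h1 2 3 (by decide)],
    by linarith [h1 2 4 (by decide)],
    by linarith [h3 0 1 2 (by decide) (by decide) (by decide)],
    by linarith [h3 1 0 2 (by decide) (by decide) (by decide)],
    by linarith [h3 2 0 1 (by decide) (by decide) (by decide)],
    by linarith [h4 0 1 2 3 4 (by decide)],
    by linarith [h1 3 0 (by decide), hs 3 0],
    by linarith [h1 3 1 (by decide), hs 3 1],
    by linarith [h1 3 2 (by decide), hs 3 2],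
    by linarith [h1 3 4 (by decide)],
    by linarith [h1 4 0 (by decide), hs 4 0],
    by linarith [h1 4 1 (by decide), hs 4 1],
    by linarith [h1 4 2 (by decide), hs 4 2],
    by linarith [h1 4 3 (by decide), hs 4 3],
    by simp⟩

theorem apply_Dvec_nonneg {d : ℝ} {m : Fin 5 → ℝ} {mm : Fin 5 → Fin 5 → ℝ}
    (hs : ∀ i j, mm i j = mm j i) (h : BoundaryIneqs d m mm) {ℓ : V →ₗ[ℝ] ℝ}
    (hℓ : ∀ v ∈ BoundaryClasses ∪ KVClasses, 0 ≤ ℓ v) : 0 ≤ ℓ (Dvec d m mm) := by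
  have hfeas : Feasible (formWeights (ℓ bH) (fun i => ℓ (bE i)) fun i j => ℓ (bEE i j)) := by
    refine feasible_formWeights (fun i j => by rw [bEE_comm])
      (fun i => hℓ _ (.inl (.inl ⟨i, rfl⟩)))
      (fun i j hij => hℓ _ (.inl (.inr (.inl ⟨i, j, hij, rfl⟩)))) (fun i j k hn => ?_)
      (fun i j k h hn => ?_)
    · obtain ⟨⟨hij, hik⟩, hjk⟩ : (i ≠ j ∧ i ≠ k) ∧ j ≠ k := by simpa using hn
      have := hℓ _ (.inl (.inr (.inr ⟨i, j, k, hij, hik, hjk, rfl⟩)))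
      simp only [Delta, map_sub] at this
      linarith
    · obtain ⟨⟨hij, hik, hih⟩, ⟨hjk, hjh⟩, hkh⟩ :
        (i ≠ j ∧ i ≠ k ∧ i ≠ h) ∧ (j ≠ k ∧ j ≠ h) ∧ k ≠ h := by simpa using hn
      have := hℓ _ (.inr ⟨i, j, k, h, hij, hik, hih, hjk, hjh, hkh, rfl⟩)
      simp only [KV, map_sub, map_smul, map_add, Fin.sum_univ_five, smul_eq_mul] at this
      linarith
  have hnonneg := hfeas.generated _ fun k hk => eval_gen_divisorWeights_nonneg hs h hk
  rw [sum_formWeights_mul_divisorWeights] at hnonneg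
  simp only [Dvec, map_sub, map_smul, map_sum, smul_eq_mul]
  linarith

end WeightCone

/-- **Theorem 1.3 (n = 6), numerical core.** If `D = d·H − Σ mᵢ Eᵢ − Σ m_{ij} E_{ij}`
satisfies the boundary inequalities, then `D` is a nonnegative linear combination of
the 25 boundary classes and the 15 Keel–Vermeire classes. -/
theorem effective_of_boundary_ineqs
    (d : ℝ) (m : Fin 5 → ℝ) (mm : Fin 5 → Fin 5 → ℝ)
    (hsymm : ∀ i j, mm i j = mm j i)
    (h : BoundaryIneqs d m mm) :
    IsNonnegCombi (BoundaryClasses ∪ KVClasses) (Dvec d m mm) := by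
  exact .of_forall_nonneg finite_classes (fun _ => degree_pos) fun _ hℓ =>
    WeightCone.apply_Dvec_nonneg hsymm h hℓ
end

section
/- If D = dH − Σ_i m_i E_i − Σ_{i<j} m_{ij} E_{ij} satisfies the boundary inequalities and moreover 2d = m_{12} + m_{13} + m_{14} + m_{25} + m_{35} + m_{45}, then D is a nonnegative real linear combination of the 25 boundary classes and the 15 Keel–Vermeire classes. (Case 3 of the proof of Theorem 1.3 for n = 6.) -/
open Finset

/-- A linear combination with nonnegative coefficients, indexed by any finite type. -/
lemma IsNonnegCombi.of_fintype {ι : Type*} [Fintype ι] {S : Set V} {v : V} (c : ι → ℝ) (g : ι → V)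
    (hc : ∀ t, 0 ≤ c t) (hg : ∀ t, g t ∈ S) (hv : v = ∑ t, c t • g t) : IsNonnegCombi S v := by
  refine ⟨Fintype.card ι, c ∘ (Fintype.equivFin ι).symm, g ∘ (Fintype.equivFin ι).symm,
    fun t => hc _, fun t => hg _, ?_⟩
  rw [hv, ← Equiv.sum_comp (Fintype.equivFin ι).symm]
  rfl

lemma Finset.univ_eq_of_nodup_fin_five {i j k h l : Fin 5} (hn : [i, j, k, h, l].Nodup) :
    ({i, j, k, h, l} : Finset (Fin 5)) = univ := by
  have hcard := List.toFinset_card_of_nodup hn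
  rw [← Finset.card_eq_iff_eq_univ]
  simpa using hcard

lemma BoundaryIneqs.sum_edges_le {d : ℝ} {m : Fin 5 → ℝ} {mm : Fin 5 → Fin 5 → ℝ}
    (h : BoundaryIneqs d m mm) {i a b c j : Fin 5} (hn : [i, a, b, c, j].Nodup) :
    mm i a + mm i b + mm i c + mm i j ≤ 2 * m i := by
  have hset : univ.filter (fun k => k ≠ i) = {a, b, c, j} := by
    rw [← Finset.univ_eq_of_nodup_fin_five hn]
    ext k
    simp at hn ⊢
    grind
  have hi := h.2.1 i
  simp at hn
  rw [hset, sum_insert (by grind), sum_insert (by grind), sum_insert (by grind),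
    sum_singleton] at hi
  linarith

/-- The boundary inequalities together with the vanishing of `2d − Σ m_e`, the sum running over
the edges `e` of the complete bipartite graph on `{i, j}` and `{a, b, c}`. -/
structure BipartiteFace (d : ℝ) (m : Fin 5 → ℝ) (mm : Fin 5 → Fin 5 → ℝ) (i a b c j : Fin 5) :
    Prop where
  ineqs : BoundaryIneqs d m mm
  symm : ∀ k l, mm k l = mm l k
  nodup : [i, a, b, c, j].Nodup
  two_mul_d : 2 * d = mm i a + mm i b + mm i c + mm j a + mm j b + mm j c

/-- How much the coefficient of `Δ_{ija}` must exceed that of `KV_{ij,bc}`, up to half the total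
of the coefficients of `Δ_{ija}`, `Δ_{ijb}` and `Δ_{ijc}`. -/
noncomputable def excess (d : ℝ) (mm : Fin 5 → Fin 5 → ℝ) (i j a b c : Fin 5) : ℝ :=
  max (max ((mm i a - mm i b - mm i c) / 2) ((mm j a - mm j b - mm j c) / 2))
    ((mm b c + mm i a + mm j a - d) / 2)

/-- The slack `m_{ia} + m_{ja} − m_a`. -/
noncomputable def slack (m : Fin 5 → ℝ) (mm : Fin 5 → Fin 5 → ℝ) (i j a : Fin 5) : ℝ :=
  mm i a + mm j a - m a

/-- The deficit `2m_i − m_{ia} − m_{ib} − m_{ic}`. -/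
noncomputable def deficit (m : Fin 5 → ℝ) (mm : Fin 5 → Fin 5 → ℝ) (i a b c : Fin 5) : ℝ :=
  2 * m i - (mm i a + mm i b + mm i c)

lemma excess_cases (d : ℝ) (mm : Fin 5 → Fin 5 → ℝ) (i j a b c : Fin 5) :
    excess d mm i j a b c = (mm i a - mm i b - mm i c) / 2 ∨
    excess d mm i j a b c = (mm j a - mm j b - mm j c) / 2 ∨
    excess d mm i j a b c = (mm b c + mm i a + mm j a - d) / 2 := by
  unfold excess
  grind

lemma excess_bounds (d : ℝ) (mm : Fin 5 → Fin 5 → ℝ) (i j a b c : Fin 5) :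
    (mm i a - mm i b - mm i c) / 2 ≤ excess d mm i j a b c ∧
    (mm j a - mm j b - mm j c) / 2 ≤ excess d mm i j a b c ∧
    (mm b c + mm i a + mm j a - d) / 2 ≤ excess d mm i j a b c := by
  unfold excess
  grind

lemma excess_comm (d : ℝ) (mm : Fin 5 → Fin 5 → ℝ) (i j a b c : Fin 5) :
    excess d mm j i a b c = excess d mm i j a b c := by
  unfold excess
  rw [max_comm ((mm j a - mm j b - mm j c) / 2), add_right_comm]

lemma slack_comm (m : Fin 5 → ℝ) (mm : Fin 5 → Fin 5 → ℝ) (i j a : Fin 5) :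
    slack m mm j i a = slack m mm i j a := by
  unfold slack
  ring

namespace BipartiteFace

variable {d : ℝ} {m : Fin 5 → ℝ} {mm : Fin 5 → Fin 5 → ℝ} {i a b c j : Fin 5}

lemma swap_ends (F : BipartiteFace d m mm i a b c j) : BipartiteFace d m mm j a b c i where
  ineqs := F.ineqs
  symm := F.symm
  nodup := by
    have hn := F.nodup
    simp at hn ⊢
    grind
  two_mul_d := by linarith [F.two_mul_d]

lemma rotate (F : BipartiteFace d m mm i a b c j) : BipartiteFace d m mm i b c a j where
  ineqs := F.ineqs
  symm := F.symm
  nodup := by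
    have hn := F.nodup
    simp at hn ⊢
    grind
  two_mul_d := by linarith [F.two_mul_d]

lemma le_deficit (F : BipartiteFace d m mm i a b c j) : mm i j ≤ deficit m mm i a b c := by
  have hi := F.ineqs.sum_edges_le F.nodup
  unfold deficit
  linarith

lemma edge_nonneg (F : BipartiteFace d m mm i a b c j) : 0 ≤ mm i j := by
  have hn := F.nodup
  simp at hn
  exact F.ineqs.2.2.2.2.2.1 i j (by grind)

lemma le_apex (F : BipartiteFace d m mm i a b c j) :
    mm i a ≤ m i ∧ mm i b ≤ m i ∧ mm i a ≤ m a ∧ mm j a ≤ m a := by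
  have hn := F.nodup
  have h1 := F.ineqs.1
  simp at hn
  refine ⟨h1 i a ?_, h1 i b ?_, ?_, ?_⟩
  · grind
  · grind
  · rw [F.symm]; exact h1 a i (by grind)
  · rw [F.symm]; exact h1 a j (by grind)

lemma triangle_add_edge_le (F : BipartiteFace d m mm i a b c j) :
    mm j b + mm j c + mm b c + mm i a ≤ d ∧ mm i j + mm i a + mm j a + mm b c ≤ d := by
  have hn := F.nodup
  have h5 := F.ineqs.2.2.2.2.1
  simp at hn
  constructor <;> apply h5 <;> apply Finset.univ_eq_of_nodup_fin_five <;> simp <;> grind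

lemma apex_add_edge_le (F : BipartiteFace d m mm i a b c j) :
    m i + mm j a ≤ d ∧ m i + mm b c ≤ d ∧ m a + mm b c ≤ d ∧
    m a + mm i b ≤ d ∧ m a + mm i c ≤ d ∧ m a + mm j b ≤ d ∧ m a + mm j c ≤ d := by
  have hn := F.nodup
  have h3 := F.ineqs.2.2.1
  simp at hn
  refine ⟨?_, ?_, ?_, ?_, ?_, ?_, ?_⟩ <;> apply h3 <;> grind

lemma apex_add_apex_le (F : BipartiteFace d m mm i a b c j) :
    m i + m a ≤ d + mm i a ∧ m i + m j ≤ d + mm i j := by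
  have hn := F.nodup
  have h7 := F.ineqs.2.2.2.2.2.2
  simp at hn
  constructor <;> apply h7 <;> grind

lemma three_apices_add_edge_le (F : BipartiteFace d m mm i a b c j) :
    m a + m b + m j + mm i c ≤ 2 * d := by
  have hn := F.nodup
  simp at hn
  exact F.ineqs.2.2.2.1 a b j i c (Finset.univ_eq_of_nodup_fin_five (by simp; grind))

lemma nonneg_edge (F : BipartiteFace d m mm i a b c j) : 0 ≤ mm i a := by
  have hn := F.nodup
  simp at hn
  exact F.ineqs.2.2.2.2.2.1 i a (by grind)

lemma two_mul_excess_le (F : BipartiteFace d m mm i a b c j) {L : ℝ}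
    (hi : deficit m mm i a b c ≤ L) (hj : deficit m mm j a b c ≤ L) :
    2 * excess d mm i j a b c ≤ L := by
  have := F.le_apex.1
  have := F.swap_ends.le_apex.1
  have := F.triangle_add_edge_le.2
  have := F.le_deficit
  have := F.edge_nonneg
  unfold deficit at *
  rcases excess_cases d mm i j a b c with h | h | h <;> rw [h] <;> linarith

lemma excess_add_excess_nonpos (F : BipartiteFace d m mm i a b c j) :
    excess d mm i j a b c + excess d mm i j b c a ≤ 0 := by
  have := F.le_apex
  have := F.apex_add_edge_le.1
  have := F.rotate.apex_add_edge_le.1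
  have := F.triangle_add_edge_le.1
  have := F.rotate.triangle_add_edge_le.1
  have := F.rotate.rotate.nonneg_edge
  have := F.edge_nonneg
  have := F.ineqs.sum_edges_le F.nodup
  have := F.two_mul_d
  have := F.symm a c
  rcases excess_cases d mm i j a b c with h | h | h <;>
    rcases excess_cases d mm i j b c a with h' | h' | h' <;> rw [h, h'] <;> linarith

lemma excess_sum_add_deficit_nonpos (F : BipartiteFace d m mm i a b c j) :
    excess d mm i j a b c + excess d mm i j b c a + excess d mm i j c a b +
      deficit m mm i a b c / 2 ≤ 0 := by
  have := F.le_apex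
  have := F.apex_add_edge_le
  have := F.rotate.apex_add_edge_le.1
  have := F.rotate.rotate.apex_add_edge_le.1
  have := F.triangle_add_edge_le.1
  have := F.rotate.triangle_add_edge_le.1
  have := F.rotate.rotate.triangle_add_edge_le.1
  have := F.rotate.nonneg_edge
  have := F.rotate.rotate.nonneg_edge
  have := F.apex_add_apex_le.1
  have := F.two_mul_d
  have := F.symm a c
  have := F.symm a b
  have := F.symm b c
  unfold deficit
  rcases excess_cases d mm i j a b c with h | h | h <;>
    rcases excess_cases d mm i j b c a with h' | h' | h' <;>
    rcases excess_cases d mm i j c a b with h'' | h'' | h'' <;> rw [h, h', h''] <;> linarith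

lemma deficit_le_slack_sub_excess (F : BipartiteFace d m mm i a b c j) :
    deficit m mm i a b c / 2 ≤ slack m mm i j a - excess d mm i j a b c := by
  have := F.apex_add_edge_le
  have := F.rotate.rotate.apex_add_edge_le.1
  have := F.apex_add_apex_le.1
  have := F.triangle_add_edge_le.1
  have := F.two_mul_d
  unfold deficit slack
  rcases excess_cases d mm i j a b c with h | h | h <;> rw [h] <;> linarith

lemma deficit_add_excess_le (F : BipartiteFace d m mm i a b c j) :
    deficit m mm i a b c / 2 + excess d mm i j a b c ≤ slack m mm i j a + slack m mm i j b ∧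
    deficit m mm i a b c / 2 + excess d mm i j b c a ≤ slack m mm i j a + slack m mm i j b := by
  have := F.apex_add_edge_le
  have := F.rotate.apex_add_edge_le
  have := F.rotate.rotate.apex_add_edge_le.1
  have := F.apex_add_apex_le.1
  have := F.rotate.apex_add_apex_le.1
  have := F.triangle_add_edge_le.1
  have := F.rotate.triangle_add_edge_le.1
  have := F.two_mul_d
  have := F.symm a c
  unfold deficit slack
  constructor
  · rcases excess_cases d mm i j a b c with h | h | h <;> rw [h] <;> linarith
  · rcases excess_cases d mm i j b c a with h | h | h <;> rw [h] <;> linarith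

lemma slack_add_slack_nonneg (F : BipartiteFace d m mm i a b c j) :
    0 ≤ slack m mm i j a + slack m mm i j b := by
  have := F.apex_add_edge_le
  have := F.rotate.apex_add_edge_le
  have := F.two_mul_d
  unfold slack
  linarith

lemma deficit_le_slack_sum (F : BipartiteFace d m mm i a b c j) :
    deficit m mm i a b c ≤ slack m mm i j a + slack m mm i j b + slack m mm i j c := by
  have := F.three_apices_add_edge_le
  have := F.rotate.three_apices_add_edge_le
  have := F.rotate.rotate.three_apices_add_edge_le
  have := F.apex_add_edge_le.1
  have := F.rotate.apex_add_edge_le.1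
  have := F.rotate.rotate.apex_add_edge_le.1
  have := F.apex_add_apex_le.2
  have := F.edge_nonneg
  have := F.swap_ends.ineqs.sum_edges_le F.swap_ends.nodup
  have := F.two_mul_d
  have := F.symm i j
  unfold deficit slack
  linarith

lemma deficit_le_slack_sum_add_slack (F : BipartiteFace d m mm i a b c j) :
    deficit m mm i a b c ≤
      slack m mm i j a + slack m mm i j b + 2 * slack m mm i j c := by
  have := F.rotate.three_apices_add_edge_le
  have := F.rotate.rotate.three_apices_add_edge_le
  have := F.apex_add_edge_le.1
  have := F.rotate.apex_add_edge_le.1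
  have := F.edge_nonneg
  have := F.swap_ends.ineqs.sum_edges_le F.swap_ends.nodup
  have := F.two_mul_d
  have := F.symm i j
  unfold deficit slack
  linarith

end BipartiteFace

/-- The system of inequalities satisfied by the coefficients `y` of the classes `Δ_{ija}` and `z`
of the Keel–Vermeire classes is solvable. -/
lemma exists_coefficients {L c₁ c₂ c₃ s₁ s₂ s₃ : ℝ} (hL : 0 ≤ L)
    (hc₁ : 2 * c₁ ≤ L) (hc₂ : 2 * c₂ ≤ L) (hc₃ : 2 * c₃ ≤ L)
    (hc₁₂ : c₁ + c₂ ≤ 0) (hc₂₃ : c₂ + c₃ ≤ 0) (hc₃₁ : c₃ + c₁ ≤ 0)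
    (hc : c₁ + c₂ + c₃ + L / 2 ≤ 0)
    (hs₁ : L / 2 ≤ s₁ - c₁) (hs₂ : L / 2 ≤ s₂ - c₂) (hs₃ : L / 2 ≤ s₃ - c₃)
    (hs₁₂ : 0 ≤ s₁ + s₂) (hs₂₃ : 0 ≤ s₂ + s₃) (hs₃₁ : 0 ≤ s₃ + s₁)
    (h₁₂ : L / 2 + c₁ ≤ s₁ + s₂ ∧ L / 2 + c₂ ≤ s₁ + s₂)
    (h₂₃ : L / 2 + c₂ ≤ s₂ + s₃ ∧ L / 2 + c₃ ≤ s₂ + s₃)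
    (h₃₁ : L / 2 + c₃ ≤ s₃ + s₁ ∧ L / 2 + c₁ ≤ s₃ + s₁)
    (hs : L ≤ s₁ + s₂ + s₃) (hs₁' : L ≤ s₂ + s₃ + 2 * s₁) (hs₂' : L ≤ s₃ + s₁ + 2 * s₂)
    (hs₃' : L ≤ s₁ + s₂ + 2 * s₃) :
    ∃ y₁ y₂ y₃ z₁ z₂ z₃ : ℝ, y₁ + y₂ + y₃ = L ∧
      0 ≤ y₁ ∧ 0 ≤ y₂ ∧ 0 ≤ y₃ ∧ 0 ≤ z₁ ∧ 0 ≤ z₂ ∧ 0 ≤ z₃ ∧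
      c₁ + L / 2 ≤ y₁ - z₁ ∧ c₂ + L / 2 ≤ y₂ - z₂ ∧ c₃ + L / 2 ≤ y₃ - z₃ ∧
      y₁ + z₂ + z₃ - z₁ ≤ s₁ ∧ y₂ + z₃ + z₁ - z₂ ≤ s₂ ∧ y₃ + z₁ + z₂ - z₃ ≤ s₃ := by
  have hmax (c s : ℝ) : ∃ l, 0 ≤ l ∧ c + L / 2 ≤ l ∧ L - s ≤ l ∧
      (l = 0 ∨ l = c + L / 2 ∨ l = L - s) :=
    ⟨max 0 (max (c + L / 2) (L - s)), by grind⟩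
  obtain ⟨l₁, h₁, h₁c, h₁s, e₁⟩ := hmax c₁ (s₂ + s₃)
  obtain ⟨l₂, h₂, h₂c, h₂s, e₂⟩ := hmax c₂ (s₃ + s₁)
  obtain ⟨l₃, h₃, h₃c, h₃s, e₃⟩ := hmax c₃ (s₁ + s₂)
  have hl : l₁ + l₂ + l₃ ≤ L := by
    obtain ⟨h₁₂, h₁₂'⟩ := h₁₂
    obtain ⟨h₂₃, h₂₃'⟩ := h₂₃
    obtain ⟨h₃₁, h₃₁'⟩ := h₃₁
    clear h₁ h₂ h₃ h₁c h₂c h₃c h₁s h₂s h₃s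
    rcases e₁ with e₁ | e₁ | e₁ <;> rcases e₂ with e₂ | e₂ | e₂ <;>
      rcases e₃ with e₃ | e₃ | e₃ <;> rw [e₁, e₂, e₃] <;> linarith
  have hpos (x : ℝ) : ∃ z, 0 ≤ z ∧ x ≤ z ∧ (z = 0 ∨ z = x) := ⟨max 0 x, by grind⟩
  obtain ⟨z₁, hz₁, hz₁', f₁⟩ := hpos (L - l₂ - l₃ - s₁)
  obtain ⟨z₂, hz₂, hz₂', f₂⟩ := hpos (l₂ - s₂)
  obtain ⟨z₃, hz₃, hz₃', f₃⟩ := hpos (l₃ - s₃)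
  refine ⟨L - l₂ - l₃, l₂, l₃, z₁, z₂, z₃, by ring, by linarith, h₂, h₃, hz₁, hz₂, hz₃,
    ?_, ?_, ?_, ?_, ?_, ?_⟩
  · rcases f₁ with f₁ | f₁ <;> linarith
  · rcases f₂ with f₂ | f₂ <;> linarith
  · rcases f₃ with f₃ | f₃ <;> linarith
  all_goals
    rcases f₁ with f₁ | f₁ <;> rcases f₂ with f₂ | f₂ <;> rcases f₃ with f₃ | f₃ <;> linarith

namespace BipartiteFace

variable {d : ℝ} {m : Fin 5 → ℝ} {mm : Fin 5 → Fin 5 → ℝ} {i a b c j : Fin 5}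

lemma exists_coefficients (F : BipartiteFace d m mm i a b c j) :
    ∃ L y₁ y₂ y₃ z₁ z₂ z₃ : ℝ, y₁ + y₂ + y₃ = L ∧
      deficit m mm i a b c ≤ L ∧ deficit m mm j a b c ≤ L ∧ mm i j ≤ L ∧
      0 ≤ y₁ ∧ 0 ≤ y₂ ∧ 0 ≤ y₃ ∧ 0 ≤ z₁ ∧ 0 ≤ z₂ ∧ 0 ≤ z₃ ∧
      excess d mm i j a b c + L / 2 ≤ y₁ - z₁ ∧ excess d mm i j b c a + L / 2 ≤ y₂ - z₂ ∧
      excess d mm i j c a b + L / 2 ≤ y₃ - z₃ ∧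
      y₁ + z₂ + z₃ - z₁ ≤ slack m mm i j a ∧ y₂ + z₃ + z₁ - z₂ ≤ slack m mm i j b ∧
      y₃ + z₁ + z₂ - z₃ ≤ slack m mm i j c := by
  wlog hij : deficit m mm j a b c ≤ deficit m mm i a b c generalizing i j
  · have := this F.swap_ends (le_of_not_ge hij)
    simp only [excess_comm d mm i j, slack_comm m mm i j, F.symm j i] at this
    grind
  have hrot : deficit m mm i b c a = deficit m mm i a b c := by unfold deficit; ring
  have hrot' : deficit m mm i c a b = deficit m mm i a b c := by unfold deficit; ring
  have hrotj : deficit m mm j b c a = deficit m mm j a b c := by unfold deficit; ring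
  have hrotj' : deficit m mm j c a b = deficit m mm j a b c := by unfold deficit; ring
  have F' := F.rotate
  have F'' := F'.rotate
  obtain ⟨y₁, y₂, y₃, z₁, z₂, z₃, hy, h⟩ := _root_.exists_coefficients
    (F.edge_nonneg.trans F.le_deficit)
    (F.two_mul_excess_le le_rfl hij)
    (F'.two_mul_excess_le hrot.le (hrotj.trans_le hij))
    (F''.two_mul_excess_le hrot'.le (hrotj'.trans_le hij))
    F.excess_add_excess_nonpos F'.excess_add_excess_nonpos F''.excess_add_excess_nonpos
    F.excess_sum_add_deficit_nonpos F.deficit_le_slack_sub_excess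
    (hrot ▸ F'.deficit_le_slack_sub_excess) (hrot' ▸ F''.deficit_le_slack_sub_excess)
    F.slack_add_slack_nonneg F'.slack_add_slack_nonneg F''.slack_add_slack_nonneg
    F.deficit_add_excess_le (hrot ▸ F'.deficit_add_excess_le)
    (hrot' ▸ F''.deficit_add_excess_le) F.deficit_le_slack_sum
    (hrot ▸ F'.deficit_le_slack_sum_add_slack) (hrot' ▸ F''.deficit_le_slack_sum_add_slack)
    F.deficit_le_slack_sum_add_slack
  exact ⟨_, y₁, y₂, y₃, z₁, z₂, z₃, hy, le_rfl, hij, F.le_deficit, h⟩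

end BipartiteFace

lemma bE_mem (i : Fin 5) : bE i ∈ BoundaryClasses ∪ KVClasses :=
  Or.inl (Or.inl ⟨i, rfl⟩)

lemma bEE_mem {i j : Fin 5} (h : i ≠ j) : bEE i j ∈ BoundaryClasses ∪ KVClasses :=
  Or.inl (Or.inr (Or.inl ⟨i, j, h, rfl⟩))

lemma Delta_mem {i j k : Fin 5} (hij : i ≠ j) (hik : i ≠ k) (hjk : j ≠ k) :
    Delta i j k ∈ BoundaryClasses ∪ KVClasses :=
  Or.inl (Or.inr (Or.inr ⟨i, j, k, hij, hik, hjk, rfl⟩))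

lemma KV_mem {i j k h : Fin 5} (hn : [i, j, k, h].Nodup) :
    KV i j k h ∈ BoundaryClasses ∪ KVClasses :=
  Or.inr ⟨i, j, k, h, by simp at hn; grind⟩

lemma Dvec_degree (d : ℝ) (m : Fin 5 → ℝ) (mm : Fin 5 → Fin 5 → ℝ) :
    Dvec d m mm (Sum.inl ()) = d := by
  simp [Dvec, bH, bE, bEE]

lemma Dvec_point (d : ℝ) (m : Fin 5 → ℝ) (mm : Fin 5 → Fin 5 → ℝ) (i : Fin 5) :
    Dvec d m mm (Sum.inr (Sum.inl i)) = -m i := by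
  simp [Dvec, bH, bE, bEE]

lemma Dvec_line (d : ℝ) (m : Fin 5 → ℝ) (mm : Fin 5 → Fin 5 → ℝ) (p : PairIdx) :
    Dvec d m mm (Sum.inr (Sum.inr p)) = -mm p.1.1 p.1.2 := by
  have key (q : PairIdx) : (p.1.1 = q.1.1 ∧ p.1.2 = q.1.2 ∨ p.1.1 = q.1.2 ∧ p.1.2 = q.1.1) ↔
      q = p := by
    obtain ⟨⟨p₁, p₂⟩, hp⟩ := p
    obtain ⟨⟨q₁, q₂⟩, hq⟩ := q
    simp only [Subtype.mk.injEq, Prod.mk.injEq] at hp hq ⊢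
    grind
  simp [Dvec, bH, bE, bEE, key]

/-- **Case 3 of the proof of Theorem 1.3 (n = 6).**  Paper indices `1,2,3,4,5`
correspond to `0,1,2,3,4 : Fin 5`.  If `D` satisfies the boundary inequalities
and `2d = m_{12} + m_{13} + m_{14} + m_{25} + m_{35} + m_{45}`, then `D` is a
nonnegative linear combination of the 25 boundary classes and the 15
Keel–Vermeire classes. -/
theorem case3_effective
    (d : ℝ) (m : Fin 5 → ℝ) (mm : Fin 5 → Fin 5 → ℝ)
    (hsymm : ∀ i j, mm i j = mm j i)
    (h : BoundaryIneqs d m mm)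
    (hd : 2 * d = mm 0 1 + mm 0 2 + mm 0 3 + mm 1 4 + mm 2 4 + mm 3 4) :
    IsNonnegCombi (BoundaryClasses ∪ KVClasses) (Dvec d m mm) := by
  rw [hsymm 1 4, hsymm 2 4, hsymm 3 4] at hd
  have F : BipartiteFace d m mm 0 1 2 3 4 := ⟨h, hsymm, by decide, hd⟩
  obtain ⟨L, y₁, y₂, y₃, z₁, z₂, z₃, hy, hL₀, hL₄, hL₀₄, hy₁, hy₂, hy₃, hz₁, hz₂, hz₃,
    hc₁, hc₂, hc₃, hs₁, hs₂, hs₃⟩ := F.exists_coefficients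
  obtain ⟨hp₁, hq₁, hn₁⟩ := excess_bounds d mm 0 4 1 2 3
  obtain ⟨hp₂, hq₂, hn₂⟩ := excess_bounds d mm 0 4 2 3 1
  obtain ⟨hp₃, hq₃, hn₃⟩ := excess_bounds d mm 0 4 3 1 2
  rw [hsymm 3 1] at hn₂
  unfold deficit at hL₀ hL₄
  unfold slack at hs₁ hs₂ hs₃
  have hx₁ : 0 ≤ (mm 0 2 + mm 0 3 - mm 0 1 - L) / 2 + y₁ - z₁ := by linarith
  have hx₂ : 0 ≤ (mm 0 3 + mm 0 1 - mm 0 2 - L) / 2 + y₂ - z₂ := by linarith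
  have hx₃ : 0 ≤ (mm 0 1 + mm 0 2 - mm 0 3 - L) / 2 + y₃ - z₃ := by linarith
  have hw₁ : 0 ≤ (mm 4 2 + mm 4 3 - mm 4 1 - L) / 2 + y₁ - z₁ := by linarith
  have hw₂ : 0 ≤ (mm 4 3 + mm 4 1 - mm 4 2 - L) / 2 + y₂ - z₂ := by linarith
  have hw₃ : 0 ≤ (mm 4 1 + mm 4 2 - mm 4 3 - L) / 2 + y₃ - z₃ := by linarith
  set x₁ := (mm 0 2 + mm 0 3 - mm 0 1 - L) / 2 + y₁ - z₁ with ex₁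
  set x₂ := (mm 0 3 + mm 0 1 - mm 0 2 - L) / 2 + y₂ - z₂ with ex₂
  set x₃ := (mm 0 1 + mm 0 2 - mm 0 3 - L) / 2 + y₃ - z₃ with ex₃
  set w₁ := (mm 4 2 + mm 4 3 - mm 4 1 - L) / 2 + y₁ - z₁ with ew₁
  set w₂ := (mm 4 3 + mm 4 1 - mm 4 2 - L) / 2 + y₂ - z₂ with ew₂
  set w₃ := (mm 4 1 + mm 4 2 - mm 4 3 - L) / 2 + y₃ - z₃ with ew₃
  refine IsNonnegCombi.of_fintype (ι := Fin 21)
    ![x₁, x₂, x₃, w₁, w₂, w₃, y₁, y₂, y₃, z₁, z₂, z₃,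
      x₁ + x₂ + x₃ + L + z₁ + z₂ + z₃ - m 0,
      x₂ + x₃ + w₂ + w₃ + y₁ + z₁ + z₂ + z₃ - m 1,
      x₁ + x₃ + w₁ + w₃ + y₂ + z₁ + z₂ + z₃ - m 2,
      x₁ + x₂ + w₁ + w₂ + y₃ + z₁ + z₂ + z₃ - m 3,
      w₁ + w₂ + w₃ + L + z₁ + z₂ + z₃ - m 4,
      L - mm 0 4, x₁ + w₁ - mm 2 3, x₂ + w₂ - mm 1 3, x₃ + w₃ - mm 1 2]
    ![Delta 0 2 3, Delta 0 1 3, Delta 0 1 2, Delta 4 2 3, Delta 4 1 3, Delta 4 1 2,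
      Delta 0 4 1, Delta 0 4 2, Delta 0 4 3, KV 0 4 2 3, KV 0 4 1 3, KV 0 4 1 2,
      bE 0, bE 1, bE 2, bE 3, bE 4, bEE 0 4, bEE 2 3, bEE 1 3, bEE 1 2] ?_ ?_ ?_
  · simp only [Fin.forall_fin_succ, Matrix.cons_val_zero, Matrix.cons_val_succ, IsEmpty.forall_iff,
      and_true]
    refine ⟨hx₁, hx₂, hx₃, hw₁, hw₂, hw₃, hy₁, hy₂, hy₃, hz₁, hz₂, hz₃, ?_⟩
    refine ⟨?_, ?_, ?_, ?_, ?_, ?_, ?_, ?_, ?_⟩ <;> linarith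
  · simp only [Fin.forall_fin_succ, Matrix.cons_val_zero, Matrix.cons_val_succ, IsEmpty.forall_iff,
      and_true]
    simp [bE_mem, bEE_mem, Delta_mem, KV_mem, -Set.mem_union]
  · funext k
    simp only [Fin.sum_univ_succ, Matrix.cons_val_zero, Matrix.cons_val_succ, Finset.univ_eq_empty,
      Finset.sum_empty, Pi.add_apply, Pi.smul_apply, smul_eq_mul, Pi.zero_apply, Delta, KV,
      Pi.sub_apply]
    rcases k with _ | i | p
    · rw [Dvec_degree]
      simp [bH, bE, bEE]
      linarith
    · rw [Dvec_point]
      fin_cases i <;> simp [bH, bE, bEE] <;> linarith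
    · rw [Dvec_line]
      obtain ⟨⟨i, j⟩, hij⟩ := p
      fin_cases i <;> fin_cases j <;> simp at hij <;> simp [bH, bE, bEE] <;>
        linarith [hsymm 1 4, hsymm 2 4, hsymm 3 4]
end
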